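/- There exists a universal constant C > 0 such that the following holds. Let X be an isotropic log-concave random vector in ℝⁿ and for 1 ≤ j ≤ 1 + log₂ n set Y_j := (X*_{2^{j−1}} − C·log(4n·2^{−j}))₊. Then for any 1 ≤ s ≤ 1 + log₂ n and any u_1,…,u_s ≥ 0, P(Y_1 ≥ u_1, …, Y_s ≥ u_s) ≤ exp(−σ_X^{−1}((1/(2C))·√(∑_{j=1}^s 2^j u_j²))). -/

import Mathlib

open MeasureTheory ProbabilityTheory Real
open scoped Pointwise ENNReal RealInnerProductSpace

noncomputable section

variable {Ω : Type*} [MeasurableSpace Ω]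

/-- A random vector `X` in `ℝⁿ` is log-concave: for all nonempty compact sets `K, L` and
`a ∈ [0,1]`, `P(X ∈ aK + (1-a)L) ≥ P(X ∈ K)^a * P(X ∈ L)^(1-a)`. -/
def IsLogConcave {n : ℕ} (μ : Measure Ω) (X : Ω → EuclideanSpace ℝ (Fin n)) : Prop :=
  ∀ K L : Set (EuclideanSpace ℝ (Fin n)), K.Nonempty → L.Nonempty →
    IsCompact K → IsCompact L → ∀ a : ℝ, 0 ≤ a → a ≤ 1 →
      (μ (X ⁻¹' K)).toReal ^ a * (μ (X ⁻¹' L)).toReal ^ (1 - a) ≤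
        (μ (X ⁻¹' (a • K + (1 - a) • L))).toReal

/-- `X` is isotropic: centered with identity covariance matrix. -/
def IsIsotropic {n : ℕ} (μ : Measure Ω) (X : Ω → EuclideanSpace ℝ (Fin n)) : Prop :=
  (∀ i, ∫ ω, X ω i ∂μ = 0) ∧
  ∀ i j, ∫ ω, X ω i * X ω j ∂μ = if i = j then (1 : ℝ) else 0

/-- `σ_X(p) = sup_{|t| = 1} (E|⟨t,X⟩|^p)^(1/p)`. -/
def sigmaX {n : ℕ} (μ : Measure Ω) (X : Ω → EuclideanSpace ℝ (Fin n)) (p : ℝ) : ℝ :=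
  ⨆ t : {t : EuclideanSpace ℝ (Fin n) // ‖t‖ = 1},
    (∫ ω, |⟪t.1, X ω⟫| ^ p ∂μ) ^ (1 / p)

/-- Generalized inverse of `σ_X`. -/
def sigmaXInv {n : ℕ} (μ : Measure Ω) (X : Ω → EuclideanSpace ℝ (Fin n)) (s : ℝ) : ℝ :=
  sSup {p : ℝ | 1 ≤ p ∧ sigmaX μ X p ≤ s}

/-- The `m`-th order statistic `X*_m` of `(|x 1|, …, |x n|)`: the `m`-th largest among the
absolute values of the coordinates, expressed as `max_{|I| = m} min_{i ∈ I} |x i|`. -/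
def orderStat {n : ℕ} (x : Fin n → ℝ) (m : ℕ) : ℝ :=
  ⨆ I : {I : Finset (Fin n) // I.card = m}, ⨅ i : I.1, |x i|

/-- A measure is log-concave when it satisfies the Brunn–Minkowski type inequality on all
measurable sets. -/
def LogConcaveMeasure {E : Type*} [NormedAddCommGroup E] [NormedSpace ℝ E] [MeasurableSpace E]
    (ν : Measure E) : Prop :=
  ∀ S T U : Set E, MeasurableSet S → MeasurableSet T → MeasurableSet U →
    ∀ a : ℝ, 0 < a → a < 1 → (∀ x ∈ S, ∀ y ∈ T, a • x + (1 - a) • y ∈ U) →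
      ν.real S ^ a * ν.real T ^ (1 - a) ≤ ν.real U

lemma exists_isCompact_mul_le_measureReal {E : Type*} [TopologicalSpace E] [MeasurableSpace E]
    (ν : Measure E) [IsFiniteMeasure ν] [ν.InnerRegularCompactLTTop] {S : Set E}
    (hS : MeasurableSet S) (hpos : 0 < ν.real S) {r : ℝ} (hr0 : 0 ≤ r) (hr1 : r < 1) :
    ∃ K ⊆ S, IsCompact K ∧ K.Nonempty ∧ r * ν.real S ≤ ν.real K := by
  have h : ENNReal.ofReal (r * ν.real S) < ν S := by
    rw [ENNReal.ofReal_lt_iff_lt_toReal (by positivity) (by finiteness)]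
    change r * ν.real S < ν.real S
    nlinarith
  obtain ⟨K, hKS, hK, hlt⟩ := hS.exists_lt_isCompact_of_ne_top (by finiteness) h
  refine ⟨K, hKS, hK, ?_, ?_⟩
  · by_contra hne
    rw [Set.not_nonempty_iff_eq_empty] at hne
    simp [hne] at hlt
  · exact ((ENNReal.ofReal_lt_iff_lt_toReal (by positivity) (by finiteness)).1 hlt).le

lemma logConcaveMeasure_of_isCompact {E : Type*} [NormedAddCommGroup E] [NormedSpace ℝ E]
    [MeasurableSpace E] (ν : Measure E) [IsFiniteMeasure ν]
    [ν.InnerRegularCompactLTTop]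
    (h : ∀ K L : Set E, K.Nonempty → L.Nonempty → IsCompact K → IsCompact L →
      ∀ a : ℝ, 0 ≤ a → a ≤ 1 →
        ν.real K ^ a * ν.real L ^ (1 - a) ≤ ν.real (a • K + (1 - a) • L)) :
    LogConcaveMeasure ν := by
  intro S T U hS hT _ a ha0 ha1 hU
  rcases (measureReal_nonneg (μ := ν) (s := S)).eq_or_lt with hS0 | hSpos
  · rw [← hS0, Real.zero_rpow ha0.ne', zero_mul]; exact measureReal_nonneg
  rcases (measureReal_nonneg (μ := ν) (s := T)).eq_or_lt with hT0 | hTpos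
  · rw [← hT0, Real.zero_rpow (by linarith), mul_zero]; exact measureReal_nonneg
  have key : ∀ r : ℝ, 0 < r → r < 1 → r * (ν.real S ^ a * ν.real T ^ (1 - a)) ≤ ν.real U := by
    intro r hr0 hr1
    obtain ⟨K, hKS, hK, hKne, hKr⟩ :=
      exists_isCompact_mul_le_measureReal ν hS hSpos hr0.le hr1
    obtain ⟨L, hLT, hL, hLne, hLr⟩ :=
      exists_isCompact_mul_le_measureReal ν hT hTpos hr0.le hr1
    calc r * (ν.real S ^ a * ν.real T ^ (1 - a))
        = (r * ν.real S) ^ a * (r * ν.real T) ^ (1 - a) := by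
          rw [Real.mul_rpow hr0.le hSpos.le, Real.mul_rpow hr0.le hTpos.le]
          have : r = r ^ a * r ^ (1 - a) := by
            rw [← Real.rpow_add hr0]; simp
          nth_rewrite 1 [this]; ring
      _ ≤ ν.real K ^ a * ν.real L ^ (1 - a) := by
          gcongr
      _ ≤ ν.real (a • K + (1 - a) • L) := h K L hKne hLne hK hL a ha0.le ha1.le
      _ ≤ ν.real U := by
          refine measureReal_mono ?_
          rintro _ ⟨_, ⟨x, hx, rfl⟩, _, ⟨y, hy, rfl⟩, rfl⟩
          exact hU x (hKS hx) y (hLT hy)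
  by_contra! hlt
  set P := ν.real S ^ a * ν.real T ^ (1 - a)
  have hP : 0 < P := by positivity
  have hr := key ((ν.real U / P + 1) / 2) (by positivity)
    (by have := (div_lt_one hP).2 hlt; linarith)
  have : ν.real U / P * P = ν.real U := by field_simp
  nlinarith

lemma IsLogConcave.logConcaveMeasure_map {Ω : Type*} [MeasurableSpace Ω] {n : ℕ} {μ : Measure Ω}
    [IsFiniteMeasure μ]
    {X : Ω → EuclideanSpace ℝ (Fin n)} (hX : Measurable X) (h : IsLogConcave μ X) :
    LogConcaveMeasure (μ.map X) := by
  refine logConcaveMeasure_of_isCompact _ fun K L hK hL hKc hLc a ha0 ha1 => ?_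
  have hsum : IsCompact (a • K + (1 - a) • L) := (hKc.smul a).add (hLc.smul (1 - a))
  rw [map_measureReal_apply hX hKc.measurableSet, map_measureReal_apply hX hLc.measurableSet,
    map_measureReal_apply hX hsum.measurableSet]
  exact h K L hK hL hKc hLc a ha0 ha1

lemma measureReal_cond {E : Type*} [MeasurableSpace E] {ν : Measure E} {A : Set E}
    (hA : MeasurableSet A) (S : Set E) : (ν[|A]).real S = (ν.real A)⁻¹ * ν.real (A ∩ S) := by
  rw [measureReal_def, cond_apply hA, ENNReal.toReal_mul, ENNReal.toReal_inv]
  rfl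

lemma LogConcaveMeasure.map {E F : Type*} [NormedAddCommGroup E] [NormedSpace ℝ E]
    [MeasurableSpace E] [BorelSpace E] [NormedAddCommGroup F] [NormedSpace ℝ F]
    [MeasurableSpace F] [BorelSpace F] {ν : Measure E} (h : LogConcaveMeasure ν) (T : E →L[ℝ] F) :
    LogConcaveMeasure (ν.map T) := by
  intro S S' U hS hS' hU a ha0 ha1 hsub
  have hT : Measurable T := T.continuous.measurable
  rw [map_measureReal_apply hT hS, map_measureReal_apply hT hS', map_measureReal_apply hT hU]
  refine h _ _ _ (hT hS) (hT hS') (hT hU) a ha0 ha1 fun x hx y hy => ?_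
  simpa using hsub _ hx _ hy

lemma LogConcaveMeasure.cond {E : Type*} [NormedAddCommGroup E] [NormedSpace ℝ E]
    [MeasurableSpace E] {ν : Measure E} (h : LogConcaveMeasure ν) {A : Set E}
    (hA : MeasurableSet A) (hconv : Convex ℝ A) : LogConcaveMeasure (ν[|A]) := by
  intro S T U hS hT hU a ha0 ha1 hsub
  rw [measureReal_cond hA, measureReal_cond hA, measureReal_cond hA]
  have key := h (A ∩ S) (A ∩ T) (A ∩ U) (hA.inter hS) (hA.inter hT) (hA.inter hU) a ha0 ha1
    fun x hx y hy => ⟨hconv hx.1 hy.1 ha0.le (by linarith) (by ring), hsub x hx.2 y hy.2⟩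
  have hc : 0 ≤ (ν.real A)⁻¹ := by positivity
  rw [Real.mul_rpow hc (by positivity), Real.mul_rpow hc (by positivity)]
  have : (ν.real A)⁻¹ = (ν.real A)⁻¹ ^ a * (ν.real A)⁻¹ ^ (1 - a) := by
    rcases hc.eq_or_lt with h0 | h0
    · rw [← h0, Real.zero_rpow ha0.ne', zero_mul]
    · rw [← Real.rpow_add h0]; simp
  calc _ = ((ν.real A)⁻¹ ^ a * (ν.real A)⁻¹ ^ (1 - a)) *
        (ν.real (A ∩ S) ^ a * ν.real (A ∩ T) ^ (1 - a)) := by ring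
    _ ≤ _ := by rw [← this]; gcongr

/-- Borell's lemma: exponential decay of the tails of a seminorm. -/
lemma LogConcaveMeasure.tail_le {E F : Type*} [NormedAddCommGroup E] [NormedSpace ℝ E]
    [MeasurableSpace E] [BorelSpace E] [NormedAddCommGroup F] [NormedSpace ℝ F] {ν : Measure E}
    [IsProbabilityMeasure ν] (h : LogConcaveMeasure ν)
    (T : E →L[ℝ] F) {p r t : ℝ} (hp : 1 ≤ p) (ht : 1 ≤ t)
    (hr : ν.real {x | r ≤ ‖T x‖} ≤ exp (-p)) :
    ν.real {x | t * r ≤ ‖T x‖} ≤ exp (-(p * t / 4)) := by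
  rcases ht.eq_or_lt with rfl | ht
  · rw [one_mul]
    exact hr.trans (exp_le_exp.2 (by linarith))
  have hcont : Continuous fun x => ‖T x‖ := by fun_prop
  have hm : ∀ c : ℝ, MeasurableSet {x | c ≤ ‖T x‖} := fun c =>
    measurableSet_le measurable_const hcont.measurable
  have ht1 : 0 < t + 1 := by linarith
  have key := h {x | t * r ≤ ‖T x‖} {x | r ≤ ‖T x‖}ᶜ {x | r ≤ ‖T x‖} (hm _) (hm _).compl (hm _)
    (2 / (t + 1)) (by positivity) (by rw [div_lt_one ht1]; linarith) (by
      intro x hx y hy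
      simp only [Set.mem_ofPred_eq, Set.mem_compl_iff, not_le] at hx hy ⊢
      have e1 : 1 - 2 / (t + 1) = (t - 1) / (t + 1) := by field_simp; ring
      have hnn : 0 ≤ (t - 1) / (t + 1) := div_nonneg (by linarith) ht1.le
      rw [e1, map_add, map_smul, map_smul]
      have h1 := norm_sub_le_norm_add ((2 / (t + 1)) • T x) (((t - 1) / (t + 1)) • T y)
      rw [norm_smul, norm_smul, Real.norm_of_nonneg hnn, Real.norm_of_nonneg (by positivity)] at h1
      have h2 : 2 / (t + 1) * (t * r) ≤ 2 / (t + 1) * ‖T x‖ := by gcongr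
      have h3 : (t - 1) / (t + 1) * ‖T y‖ ≤ (t - 1) / (t + 1) * r := by gcongr
      have h4 : r = 2 / (t + 1) * (t * r) - (t - 1) / (t + 1) * r := by field_simp; ring
      linarith)
  rw [probReal_compl_eq_one_sub (hm r)] at key
  have hb : exp (-(p / 2)) ≤ 1 - ν.real {x | r ≤ ‖T x‖} := by
    set y := exp (-(p / 2)) with hy
    have hy2 : exp (-p) = y * y := by rw [hy, ← exp_add]; congr 1; ring
    have hy0 : 0 < y := exp_pos _
    have hy1 : y ≤ exp (-(1 / 2)) := exp_le_exp.2 (by linarith)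
    have hz : exp (-(1 / 2 : ℝ)) ≤ 0.617 := by
      have h1 : exp (-(1 / 2 : ℝ)) * exp (-(1 / 2 : ℝ)) * exp 1 = 1 := by
        rw [← exp_add, ← exp_add]; norm_num
      have h2 := exp_one_gt_d9
      have h3 := exp_pos (-(1 / 2 : ℝ))
      by_contra! hlt
      nlinarith [mul_pos h3 h3]
    nlinarith
  by_contra! hlt
  have e1 : 1 - 2 / (t + 1) = (t - 1) / (t + 1) := by field_simp; ring
  have hnn : 0 ≤ (t - 1) / (t + 1) := div_nonneg (by linarith) ht1.le
  have hl : exp (-(p * t / 4) * (2 / (t + 1))) < ν.real {x | t * r ≤ ‖T x‖} ^ (2 / (t + 1)) := by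
    rw [Real.exp_mul]
    exact Real.rpow_lt_rpow (exp_pos _).le hlt (by positivity)
  have hr' : exp (-(p / 2) * (1 - 2 / (t + 1))) ≤
      (1 - ν.real {x | r ≤ ‖T x‖}) ^ (1 - 2 / (t + 1)) := by
    rw [Real.exp_mul]
    exact Real.rpow_le_rpow (exp_pos _).le hb (by rw [e1]; exact hnn)
  have hlt2 := mul_lt_mul hl hr' (exp_pos _) (by positivity)
  rw [← exp_add] at hlt2
  have hfin : exp (-p) ≤ exp (-(p * t / 4) * (2 / (t + 1)) + -(p / 2) * (1 - 2 / (t + 1))) := by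
    apply exp_le_exp.2
    rw [e1]
    have : -(p * t / 4) * (2 / (t + 1)) + -(p / 2) * ((t - 1) / (t + 1))
      = -p + p * (3 / (2 * (t + 1))) := by field_simp; ring
    rw [this]
    have : 0 ≤ p * (3 / (2 * (t + 1))) := by positivity
    linarith
  linarith

lemma lintegral_eq_mul_lintegral_comp_two_smul {E : Type*} [NormedAddCommGroup E]
    [NormedSpace ℝ E] [FiniteDimensional ℝ E] [MeasurableSpace E] [BorelSpace E]
    (m : Measure E) [m.IsAddHaarMeasure] {f : E → ℝ≥0∞} (hf : Measurable f) :
    ∫⁻ x, f x ∂m = 2 ^ Module.finrank ℝ E * ∫⁻ z, f ((2 : ℝ) • z) ∂m := by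
  have h := Measure.map_addHaar_smul m (two_ne_zero (α := ℝ))
  rw [← lintegral_map (μ := m) hf (measurable_const_smul (2 : ℝ)), h, lintegral_smul_measure,
    smul_eq_mul, ← mul_assoc]
  have h2 : (2 : ℝ≥0∞) ^ Module.finrank ℝ E = ENNReal.ofReal ((2 : ℝ) ^ Module.finrank ℝ E) := by
    rw [ENNReal.ofReal_pow (by norm_num)]; simp
  rw [h2, ← ENNReal.ofReal_mul (by positivity), abs_of_pos (by positivity),
    mul_inv_cancel₀ (by positivity)]
  simp

lemma LogConcaveMeasure.closedBall_mul_le {E : Type*} [NormedAddCommGroup E]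
    [InnerProductSpace ℝ E] [MeasurableSpace E] [BorelSpace E] {μ : Measure E} (h : LogConcaveMeasure μ) (r : ℝ)
    (x y : E) {a : ℝ} (ha0 : 0 < a) (ha1 : a < 1) :
    μ.real (Metric.closedBall x r) ^ a * μ.real (Metric.closedBall y r) ^ (1 - a) ≤
      μ.real (Metric.closedBall (a • x + (1 - a) • y) r) := by
  refine h _ _ _ measurableSet_closedBall measurableSet_closedBall measurableSet_closedBall a
    ha0 ha1 fun z hz w hw => ?_
  rw [Metric.mem_closedBall, dist_eq_norm] at *
  have e : a • z + (1 - a) • w - (a • x + (1 - a) • y) = a • (z - x) + (1 - a) • (w - y) := by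
    module
  rw [e]
  calc _ ≤ ‖a • (z - x)‖ + ‖(1 - a) • (w - y)‖ := norm_add_le _ _
    _ = a * ‖z - x‖ + (1 - a) * ‖w - y‖ := by
      rw [norm_smul, norm_smul, Real.norm_of_nonneg ha0.le, Real.norm_of_nonneg (by linarith)]
    _ ≤ a * r + (1 - a) * r := by
      have : 0 ≤ 1 - a := by linarith
      gcongr
    _ = r := by ring

section

variable {E : Type*} [NormedAddCommGroup E] [InnerProductSpace ℝ E] [FiniteDimensional ℝ E]
  [MeasurableSpace E] [BorelSpace E]

/-- In dimension `d` a log-concave measure has some direction with small tails at level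
`exp (-c d)`. -/
lemma LogConcaveMeasure.exists_direction {μ : Measure E} [IsProbabilityMeasure μ]
    (h : LogConcaveMeasure μ) (hd : 1 ≤ Module.finrank ℝ E) {r c : ℝ} (hr : 0 < r)
    (hμ : 1 / 2 ≤ μ.real (Metric.closedBall 0 r)) :
    ∃ v : E, ‖v‖ = 1 ∧ μ.real {y | (2 * exp (c + 1) + 1) * r ≤ ⟪v, y⟫} ≤
      2 ^ Module.finrank ℝ E * (2 * exp (-(c * Module.finrank ℝ E))) := by
  set d := Module.finrank ℝ E with hd_def
  set δ := exp (-(c * d)) with hδ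
  set ρ := exp (c + 1) * r with hρ
  have hρ0 : 0 < ρ := by positivity
  let vol : Measure E := volume
  have hsetm : MeasurableSet {z : E × E | dist z.2 z.1 ≤ r} :=
    (isClosed_le (by fun_prop) (by fun_prop)).measurableSet
  have hG : Measurable fun x => μ (Metric.closedBall x r) :=
    measurable_measure_prodMk_left (ν := μ) hsetm
  have hslice : ∀ S : Set E, MeasurableSet S →
      ∫⁻ x, μ (Metric.closedBall x r ∩ S) ∂vol = vol (Metric.closedBall 0 r) * μ S := by
    intro S hS
    have hm : MeasurableSet ({z : E × E | dist z.2 z.1 ≤ r} ∩ Prod.snd ⁻¹' S) :=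
      hsetm.inter (measurable_snd hS)
    have h1 := Measure.prod_apply (μ := vol) (ν := μ) hm
    have h2 := Measure.prod_apply_symm (μ := vol) (ν := μ) hm
    rw [h1] at h2
    refine h2.trans ?_
    rw [← lintegral_indicator_const hS]
    refine lintegral_congr fun y => ?_
    by_cases hy : y ∈ S
    · rw [Set.indicator_of_mem hy]
      have : (fun x : E => (x, y)) ⁻¹' ({z : E × E | dist z.2 z.1 ≤ r} ∩ Prod.snd ⁻¹' S) =
          Metric.closedBall y r := by
        ext x; simp [hy, dist_comm]
      rw [this, Measure.addHaar_closedBall_center]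
    · rw [Set.indicator_of_notMem hy]
      have : (fun x : E => (x, y)) ⁻¹' ({z : E × E | dist z.2 z.1 ≤ r} ∩ Prod.snd ⁻¹' S) = ∅ := by
        ext x; simp [hy]
      rw [this, measure_empty]
  have hG1 : ∫⁻ x, μ (Metric.closedBall x r) ∂vol = vol (Metric.closedBall 0 r) := by
    simpa using hslice Set.univ MeasurableSet.univ
  have hvr : vol (Metric.closedBall (0 : E) r) = ENNReal.ofReal (r ^ d) * vol (Metric.ball 0 1) :=
    Measure.addHaar_closedBall _ _ hr.le
  have hv1 : vol (Metric.ball (0 : E) 1) ≠ 0 := (Metric.measure_ball_pos _ _ one_pos).ne'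
  have hv1' : vol (Metric.ball (0 : E) 1) ≠ ∞ := measure_ball_lt_top.ne
  have hvr0 : vol (Metric.closedBall (0 : E) r) ≠ 0 :=
    (Metric.measure_closedBall_pos _ _ hr).ne'
  have hvrt : vol (Metric.closedBall (0 : E) r) ≠ ∞ := measure_closedBall_lt_top.ne
  let D : Set E := {x | δ ≤ μ.real (Metric.closedBall x r)}
  have hDconv : Convex ℝ D := by
    rw [convex_iff_forall_pos]
    intro x hx y hy a b ha hb hab
    obtain rfl : b = 1 - a := by linarith
    have hδ0 : 0 < δ := exp_pos _
    refine le_trans ?_ (h.closedBall_mul_le r x y ha (by linarith))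
    calc δ = δ ^ a * δ ^ (1 - a) := by rw [← Real.rpow_add hδ0]; simp
      _ ≤ _ := by gcongr <;> assumption
  have hDvol : vol D * ENNReal.ofReal δ ≤ vol (Metric.closedBall 0 r) := by
    rw [← hG1, mul_comm]
    refine le_trans ?_ (mul_meas_ge_le_lintegral hG (ENNReal.ofReal δ))
    gcongr
    rintro x (hx : δ ≤ μ.real (Metric.closedBall x r))
    exact ENNReal.ofReal_le_of_le_toReal hx
  obtain ⟨x₀, hx₀, hx₀D⟩ : ∃ x₀ ∈ Metric.ball (0 : E) ρ, x₀ ∉ closure D := by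
    by_contra! hsub
    have h1 : vol (Metric.ball (0 : E) ρ) ≤ vol D := by
      calc _ ≤ vol (closure D) := measure_mono hsub
        _ ≤ vol (D ∪ frontier D) := by
          rw [← closure_eq_self_union_frontier]
        _ ≤ vol D + vol (frontier D) := measure_union_le _ _
        _ = vol D := by rw [hDconv.addHaar_frontier vol, add_zero]
    rw [Measure.addHaar_ball_of_pos _ _ hρ0] at h1
    have h2 := (mul_le_mul_left h1 (ENNReal.ofReal δ)).trans hDvol
    rw [hvr, mul_right_comm, ENNReal.mul_le_mul_iff_left hv1 hv1',
      ← ENNReal.ofReal_mul (by positivity), ENNReal.ofReal_le_ofReal_iff (by positivity)] at h2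
    have h3 : ρ ^ d * δ = exp d * r ^ d := by
      rw [hρ, hδ, mul_pow, ← exp_nat_mul, mul_right_comm, ← exp_add]
      congr 2; ring
    rw [h3] at h2
    have h4 : 1 < exp (d : ℝ) := by
      rw [Real.one_lt_exp_iff]; exact_mod_cast hd
    have h5 : 0 < r ^ d := by positivity
    nlinarith
  obtain ⟨f, u, hfu, hux⟩ := geometric_hahn_banach_closed_point hDconv.closure isClosed_closure hx₀D
  obtain ⟨w, rfl⟩ := (InnerProductSpace.toDual ℝ E).surjective f
  simp only [InnerProductSpace.toDual_apply_apply] at hfu hux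
  by_cases hD0 : δ ≤ 1 / 2
  swap
  · obtain ⟨v, hv⟩ : ∃ v : E, ‖v‖ = 1 := by
      have : Nontrivial E := Module.nontrivial_of_finrank_pos (R := ℝ) (by omega)
      exact exists_norm_eq E zero_le_one
    refine ⟨v, hv, measureReal_le_one.trans ?_⟩
    have : (1 : ℝ) ≤ 2 ^ d := one_le_pow₀ (by norm_num)
    nlinarith
  have h0D : (0 : E) ∈ D := hD0.trans hμ
  have hu0 : 0 < u := by simpa using hfu 0 (subset_closure h0D)
  have hw0 : 0 < ‖w‖ := by
    rw [norm_pos_iff]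
    rintro rfl
    simp at hux; linarith
  have hcs : ⟪w, x₀⟫ ≤ ‖w‖ * ρ := (real_inner_le_norm _ _).trans
    (by gcongr; simpa using (Metric.mem_ball.1 hx₀).le)
  refine ⟨‖w‖⁻¹ • w, by rw [norm_smul]; simp [hw0.ne'], ?_⟩
  set v := ‖w‖⁻¹ • w with hv
  have hvn : ‖v‖ = 1 := by rw [hv, norm_smul]; simp [hw0.ne']
  have hout : ∀ z, ρ ≤ ⟪v, z⟫ → μ.real (Metric.closedBall z r) < δ := by
    intro z hz
    by_contra! hzD
    have h1 := hfu z (subset_closure hzD)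
    rw [hv, real_inner_smul_left, inv_mul_eq_div, le_div_iff₀ hw0] at hz
    linarith
  have hdouble : ∀ z, ρ ≤ ⟪v, z⟫ → μ (Metric.closedBall ((2 : ℝ) • z) r) ≤
      ENNReal.ofReal (2 * δ) * μ (Metric.closedBall z r) := by
    intro z hz
    have h1 := hout z hz
    have h2 := h.closedBall_mul_le r ((2 : ℝ) • z) 0 (a := 1 / 2) (by norm_num) (by norm_num)
    rw [smul_zero, add_zero, smul_smul, show (1 / 2 * 2 : ℝ) = 1 by norm_num, one_smul,
      show (1 - 1 / 2 : ℝ) = 1 / 2 by norm_num, ← Real.sqrt_eq_rpow, ← Real.sqrt_eq_rpow,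
      ← Real.sqrt_mul measureReal_nonneg] at h2
    have h3 := (Real.sqrt_le_left measureReal_nonneg).1 h2
    have hnn : 0 ≤ μ.real (Metric.closedBall ((2 : ℝ) • z) r) := measureReal_nonneg
    have hnn' : 0 ≤ μ.real (Metric.closedBall z r) := measureReal_nonneg
    have h4 : μ.real (Metric.closedBall ((2 : ℝ) • z) r) ≤
        2 * δ * μ.real (Metric.closedBall z r) := by nlinarith
    rw [← ofReal_measureReal, ← ofReal_measureReal, ← ENNReal.ofReal_mul (by positivity)]
    exact ENNReal.ofReal_le_ofReal h4
  set S : Set E := {y | (2 * exp (c + 1) + 1) * r ≤ ⟪v, y⟫} with hS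
  have hSm : MeasurableSet S := (isClosed_le (by fun_prop) (by fun_prop)).measurableSet
  let H₂ : Set E := {x | 2 * ρ ≤ ⟪v, x⟫}
  have hH₂ : MeasurableSet H₂ := (isClosed_le (by fun_prop) (by fun_prop)).measurableSet
  have hmain : vol (Metric.closedBall (0 : E) r) * μ S ≤
      vol (Metric.closedBall (0 : E) r) * (2 ^ d * ENNReal.ofReal (2 * δ)) := by
    calc _ = ∫⁻ x, μ (Metric.closedBall x r ∩ S) ∂vol := (hslice S hSm).symm
      _ ≤ ∫⁻ x, H₂.indicator (fun x => μ (Metric.closedBall x r)) x ∂vol := by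
        refine lintegral_mono fun x => ?_
        by_cases hx : x ∈ H₂
        · rw [Set.indicator_of_mem hx]; exact measure_mono Set.inter_subset_left
        · have : Metric.closedBall x r ∩ S = ∅ := by
            rw [Set.eq_empty_iff_forall_notMem]
            rintro y ⟨hy, hyS : (2 * exp (c + 1) + 1) * r ≤ ⟪v, y⟫⟩
            apply hx
            change 2 * ρ ≤ ⟪v, x⟫
            have h1 : ⟪v, y - x⟫ ≤ ‖v‖ * ‖y - x‖ := real_inner_le_norm _ _
            rw [Metric.mem_closedBall, dist_eq_norm] at hy
            rw [inner_sub_right, hvn, one_mul] at h1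
            rw [hρ]; linarith
          simp [this]
      _ = 2 ^ d * ∫⁻ z, H₂.indicator (fun x => μ (Metric.closedBall x r)) ((2 : ℝ) • z) ∂vol :=
        lintegral_eq_mul_lintegral_comp_two_smul vol (hG.indicator hH₂)
      _ ≤ 2 ^ d * ∫⁻ z, ENNReal.ofReal (2 * δ) * μ (Metric.closedBall z r) ∂vol := by
        gcongr with z
        by_cases hx : (2 : ℝ) • z ∈ H₂
        · rw [Set.indicator_of_mem hx]
          refine hdouble z ?_
          have hx' : 2 * ρ ≤ ⟪v, (2 : ℝ) • z⟫ := hx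
          rw [real_inner_smul_right] at hx'
          linarith
        · rw [Set.indicator_of_notMem hx]; exact bot_le
      _ = _ := by rw [lintegral_const_mul _ hG, hG1]; ring
  rw [ENNReal.mul_le_mul_iff_right hvr0 hvrt] at hmain
  have h2 : (2 : ℝ≥0∞) ^ d = ENNReal.ofReal ((2 : ℝ) ^ d) := by
    rw [ENNReal.ofReal_pow (by norm_num)]; simp
  rw [h2, ← ENNReal.ofReal_mul (by positivity)] at hmain
  exact ENNReal.toReal_le_of_le_ofReal (by positivity) hmain

/-- A volume bound for the cardinality of a separated subset of the unit ball. -/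
lemma card_mul_pow_le_of_separated {E : Type*} [NormedAddCommGroup E] [NormedSpace ℝ E]
    [FiniteDimensional ℝ E] {δ : ℝ} (hδ : 0 < δ) (s : Finset E) (hs : ∀ c ∈ s, ‖c‖ ≤ 1)
    (h : ∀ c ∈ s, ∀ d ∈ s, c ≠ d → 2 * δ ≤ dist c d) :
    s.card * δ ^ Module.finrank ℝ E ≤ (1 + δ) ^ Module.finrank ℝ E := by
  borelize E
  let m : Measure E := Measure.addHaar
  have hdisj : (s : Set E).PairwiseDisjoint fun c => Metric.ball c δ := by
    intro c hc d hd hcd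
    exact Metric.ball_disjoint_ball (by linarith [h c hc d hd hcd])
  have hsub : (⋃ c ∈ s, Metric.ball c δ) ⊆ Metric.ball (0 : E) (1 + δ) := by
    refine Set.iUnion₂_subset fun x hx => Metric.ball_subset_ball' ?_
    rw [dist_zero_right]
    linarith [hs x hx]
  have hle := measure_mono (μ := m) hsub
  rw [measure_biUnion_finset hdisj fun c _ => measurableSet_ball,
    m.addHaar_ball_of_pos _ (by positivity)] at hle
  simp only [m.addHaar_ball_of_pos _ hδ, Finset.sum_const, nsmul_eq_mul, ← mul_assoc] at hle
  have hle' := (ENNReal.mul_le_mul_iff_left (Metric.measure_ball_pos _ _ zero_lt_one).ne'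
    measure_ball_lt_top.ne).1 hle
  have := ENNReal.toReal_le_of_le_ofReal (by positivity) hle'
  rwa [ENNReal.toReal_mul, ENNReal.toReal_natCast, ENNReal.toReal_ofReal (by positivity)] at this

lemma exists_finset_net {E : Type*} [NormedAddCommGroup E] [NormedSpace ℝ E]
    [FiniteDimensional ℝ E] {δ : ℝ} (hδ : 0 < δ) :
    ∃ N : Finset E, (∀ v ∈ N, ‖v‖ = 1) ∧ (∀ x : E, ‖x‖ = 1 → ∃ v ∈ N, dist x v ≤ 2 * δ) ∧
      (N.card : ℝ) ≤ (1 + δ⁻¹) ^ Module.finrank ℝ E := by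
  have hcard : ∀ s : Finset E, (∀ c ∈ s, ‖c‖ = 1) →
      (∀ c ∈ s, ∀ d ∈ s, c ≠ d → 2 * δ ≤ dist c d) →
      (s.card : ℝ) ≤ (1 + δ⁻¹) ^ Module.finrank ℝ E := by
    intro s hs h
    have := card_mul_pow_le_of_separated hδ s (fun c hc => (hs c hc).le) h
    rw [← le_div_iff₀ (by positivity), ← div_pow] at this
    have e : (1 + δ) / δ = 1 + δ⁻¹ := by field_simp; ring
    rwa [e] at this
  let P : Set ℕ := {k | ∃ s : Finset E, ((∀ c ∈ s, ‖c‖ = 1) ∧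
    ∀ c ∈ s, ∀ d ∈ s, c ≠ d → 2 * δ ≤ dist c d) ∧ s.card = k}
  have hP : sSup P ∈ P := by
    refine Nat.sSup_mem ⟨0, ∅, by simp⟩ ⟨⌊(1 + δ⁻¹) ^ Module.finrank ℝ E⌋₊, ?_⟩
    rintro k ⟨s, ⟨hs, h⟩, rfl⟩
    exact Nat.le_floor (hcard s hs h)
  have hPb : BddAbove P := by
    refine ⟨⌊(1 + δ⁻¹) ^ Module.finrank ℝ E⌋₊, ?_⟩
    rintro k ⟨s, ⟨hs, h⟩, rfl⟩
    exact Nat.le_floor (hcard s hs h)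
  obtain ⟨N, ⟨hN, hsep⟩, hNc⟩ := hP
  refine ⟨N, hN, fun x hx => ?_, hcard N hN hsep⟩
  by_contra! hfar
  classical
  have hxN : x ∉ N := fun hxN => by
    have := hfar x hxN
    rw [dist_self] at this
    linarith
  have hmem : (insert x N).card ∈ P := by
    refine ⟨insert x N, ⟨?_, ?_⟩, rfl⟩
    · intro c hc
      rcases Finset.mem_insert.1 hc with rfl | hc
      exacts [hx, hN c hc]
    · intro c hc d hd hcd
      rcases Finset.mem_insert.1 hc with rfl | hc <;> rcases Finset.mem_insert.1 hd with rfl | hd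
      · exact absurd rfl hcd
      · exact (hfar d hd).le
      · rw [dist_comm]; exact (hfar c ‹_›).le
      · exact hsep c hc d hd hcd
  have := le_csSup hPb hmem
  rw [Finset.card_insert_of_notMem hxN, hNc] at this
  omega

section Gaussian

variable (W : Type*) [NormedAddCommGroup W] [MeasurableSpace W]

/-- The Gaussian density `exp (-‖y‖² / 2)`. -/
def gaussDensity (y : W) : ℝ≥0∞ := ENNReal.ofReal (exp (-(‖y‖ ^ 2 / 2)))

lemma measurable_gaussDensity [BorelSpace W] : Measurable (gaussDensity W) := by
  unfold gaussDensity; fun_prop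

variable [InnerProductSpace ℝ W] [FiniteDimensional ℝ W] [BorelSpace W]

/-- The unnormalized standard Gaussian measure. -/
def rawGauss : Measure W := volume.withDensity (gaussDensity W)

/-- The standard Gaussian measure on a Euclidean space. -/
def gauss : Measure W := (rawGauss W Set.univ)⁻¹ • rawGauss W

lemma rawGauss_univ_ne_zero : rawGauss W Set.univ ≠ 0 := by
  rw [rawGauss, withDensity_apply _ MeasurableSet.univ, Measure.restrict_univ]
  intro h
  rw [lintegral_eq_zero_iff (measurable_gaussDensity W)] at h
  have : (volume : Measure W) Set.univ = 0 := by
    rw [Filter.EventuallyEq, ae_iff] at h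
    convert h using 2
    ext y
    simp [gaussDensity, exp_pos]
  exact (NeZero.ne (volume : Measure W)) (Measure.measure_univ_eq_zero.1 this)

lemma rawGauss_univ_ne_top : rawGauss W Set.univ ≠ ∞ := by
  rw [rawGauss, withDensity_apply _ MeasurableSet.univ, Measure.restrict_univ]
  have h := GaussianFourier.integrable_cexp_neg_mul_sq_norm_add (V := W) (b := (1 / 2 : ℂ))
    (by norm_num) 0 0
  have h2 : Integrable (fun y : W => exp (-(‖y‖ ^ 2 / 2))) volume := by
    refine h.norm.congr (Filter.Eventually.of_forall fun y => ?_)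
    simp only [Complex.norm_exp]
    congr 1
    simp [← Complex.ofReal_pow]
    ring
  exact h2.lintegral_lt_top.ne

instance : IsProbabilityMeasure (gauss W) := by
  constructor
  rw [gauss, Measure.smul_apply, smul_eq_mul,
    ENNReal.inv_mul_cancel (rawGauss_univ_ne_zero W) (rawGauss_univ_ne_top W)]

instance : IsFiniteMeasure (rawGauss W) := ⟨(rawGauss_univ_ne_top W).lt_top⟩

variable {W}

/-- Translating a set changes its Gaussian measure at most by the extremal density ratio. -/
lemma exp_mul_gauss_le (h : W) (c : ℝ) {S U : Set W} (hS : MeasurableSet S)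
    (hU : MeasurableSet U) (hSU : ∀ y ∈ S, y + h ∈ U)
    (hc : ∀ y ∈ S, c ≤ -(⟪y, h⟫ + ‖h‖ ^ 2 / 2)) :
    exp c * (gauss W).real S ≤ (gauss W).real U := by
  have key : ENNReal.ofReal (exp c) * rawGauss W S ≤ rawGauss W U := by
    rw [rawGauss, withDensity_apply _ hS, withDensity_apply _ hU,
      ← lintegral_const_mul _ (measurable_gaussDensity W), ← lintegral_indicator hS,
      ← lintegral_indicator hU,
      ← lintegral_add_right_eq_self (fun y => U.indicator (gaussDensity W) y) h]
    refine lintegral_mono fun y => ?_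
    by_cases hy : y ∈ S
    · rw [Set.indicator_of_mem hy, Set.indicator_of_mem (hSU y hy), gaussDensity, gaussDensity,
        ← ENNReal.ofReal_mul (exp_pos _).le, ← exp_add]
      refine ENNReal.ofReal_le_ofReal (exp_le_exp.2 ?_)
      rw [norm_add_sq_real]
      linarith [hc y hy]
    · rw [Set.indicator_of_notMem hy]; exact bot_le
  rw [gauss, measureReal_ennreal_smul_apply, measureReal_ennreal_smul_apply, mul_left_comm]
  refine mul_le_mul_of_nonneg_left ?_ ENNReal.toReal_nonneg
  rw [measureReal_def, measureReal_def]
  have := ENNReal.toReal_mono (measure_ne_top _ _) key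
  rwa [ENNReal.toReal_mul, ENNReal.toReal_ofReal (exp_pos _).le] at this

lemma gauss_halfspace_le (h : W) :
    (gauss W).real {y | ‖h‖ ^ 2 ≤ ⟪y, h⟫} ≤ exp (-(‖h‖ ^ 2 / 2)) := by
  have := exp_mul_gauss_le (-h) (‖h‖ ^ 2 / 2) (S := {y | ‖h‖ ^ 2 ≤ ⟪y, h⟫}) (U := Set.univ)
    (isClosed_le (by fun_prop) (by fun_prop)).measurableSet MeasurableSet.univ (by simp)
    (fun y (hy : ‖h‖ ^ 2 ≤ ⟪y, h⟫) => by rw [inner_neg_right, norm_neg]; linarith)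
  rw [probReal_univ, ← le_div_iff₀' (exp_pos _)] at this
  rwa [exp_neg, ← one_div]

end Gaussian

lemma mul_measureReal_le_of_slices {α β : Type*} [MeasurableSpace α] [MeasurableSpace β]
    {γ : Measure α} {ν : Measure β} [IsProbabilityMeasure γ] [IsProbabilityMeasure ν]
    {S : Set (α × β)} (hS : MeasurableSet S) {η κ : ℝ} (hη : 0 ≤ η) {B : Set β}
    (h1 : ∀ x, ν.real {y | (x, y) ∈ S} ≤ η) (h2 : ∀ y ∈ B, κ ≤ γ.real {x | (x, y) ∈ S}) :
    κ * ν.real B ≤ η := by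
  have hf : Measurable fun y => γ {x | (x, y) ∈ S} := measurable_measure_prodMk_right hS
  have : ENNReal.ofReal κ * ν B ≤ ENNReal.ofReal η := by
    calc _ ≤ ENNReal.ofReal κ * ν {y | ENNReal.ofReal κ ≤ γ {x | (x, y) ∈ S}} := by
          gcongr
          intro y hy
          exact ENNReal.ofReal_le_of_le_toReal (h2 y hy)
      _ ≤ ∫⁻ y, γ {x | (x, y) ∈ S} ∂ν := mul_meas_ge_le_lintegral hf _
      _ = ∫⁻ x, ν {y | (x, y) ∈ S} ∂γ :=
        (Measure.prod_apply_symm hS).symm.trans (Measure.prod_apply hS)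
      _ ≤ ∫⁻ x, ENNReal.ofReal η ∂γ := lintegral_mono fun x => by
          rw [← ofReal_measureReal]; exact ENNReal.ofReal_le_ofReal (h1 x)
      _ = _ := by simp
  rcases le_total κ 0 with hκ | hκ
  · exact (mul_nonpos_of_nonpos_of_nonneg hκ measureReal_nonneg).trans hη
  · rw [← ofReal_measureReal, ← ENNReal.ofReal_mul hκ] at this
    exact (ENNReal.ofReal_le_ofReal_iff hη).1 this

/-- A doubling scale at which the tail of `f` drops below `c`. -/
lemma exists_dyadic_scale {α : Type*} [MeasurableSpace α] (ν : Measure α) [IsFiniteMeasure ν]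
    {f : α → ℝ} (hf : Measurable f) {C c : ℝ} (hC : 0 < C) (hc : 0 < c) :
    ∃ b, C ≤ b ∧ ν.real {x | 2 * b ≤ f x} ≤ c ∧
      (b = C ∨ 2 * C ≤ b ∧ c < ν.real {x | b ≤ f x}) := by
  have htend : Filter.Tendsto (fun k : ℕ => ν.real {x | 2 ^ (k + 1) * C ≤ f x}) Filter.atTop
      (nhds 0) := by
    have hm : ∀ k : ℕ, MeasurableSet {x | 2 ^ (k + 1) * C ≤ f x} := fun k =>
      measurableSet_le measurable_const hf
    have h3 := tendsto_measure_iInter_atTop (μ := ν) (fun k => (hm k).nullMeasurableSet) (by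
      intro k l hkl x (hx : 2 ^ (l + 1) * C ≤ f x)
      change 2 ^ (k + 1) * C ≤ f x
      refine le_trans ?_ hx
      gcongr
      norm_num) ⟨0, measure_ne_top _ _⟩
    have h4 : ⋂ k : ℕ, {x | 2 ^ (k + 1) * C ≤ f x} = ∅ := by
      ext x
      simp only [Set.mem_iInter, Set.mem_empty_iff_false, iff_false, not_forall]
      obtain ⟨k, hk⟩ := pow_unbounded_of_one_lt (f x / C) (one_lt_two (α := ℝ))
      refine ⟨k, not_le.2 (((div_lt_iff₀ hC).1 hk).trans_le ?_)⟩
      gcongr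
      exacts [by norm_num, by omega]
    rw [h4, measure_empty] at h3
    exact (ENNReal.tendsto_toReal (by simp)).comp h3
  have hex : ∃ k : ℕ, ν.real {x | 2 ^ (k + 1) * C ≤ f x} ≤ c :=
    ((htend.eventually_lt_const hc).exists).imp fun k hk => hk.le
  classical
  have hk := Nat.find_spec hex
  have hmin := fun m => Nat.find_min hex (m := m)
  set k := Nat.find hex
  refine ⟨2 ^ k * C, le_mul_of_one_le_left hC.le (one_le_pow₀ (by norm_num)), ?_, ?_⟩
  · rwa [← mul_assoc, ← pow_succ']
  · rcases Nat.eq_zero_or_pos k with h0 | h0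
    · left; rw [h0]; simp
    · right
      obtain ⟨m, hm⟩ := Nat.exists_eq_succ_of_ne_zero h0.ne'
      have h1 := hmin m (by omega)
      push Not at h1
      rw [hm]
      refine ⟨?_, h1⟩
      gcongr
      exact le_self_pow₀ (by norm_num) (by omega)

section

variable {E : Type*} [NormedAddCommGroup E] [InnerProductSpace ℝ E] {q : ℕ}

/-- The `q × E` matrices. -/
abbrev MatSpace (q : ℕ) (E : Type*) := PiLp 2 fun _ : Fin q => E

/-- The action of a matrix with rows `Γ i` on a vector. -/
def matAct (Γ : MatSpace q E) (x : E) : EuclideanSpace ℝ (Fin q) := WithLp.toLp 2 fun i => ⟪Γ i, x⟫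

/-- The rank one matrix `v ⊗ x`. -/
def rankOne (v : EuclideanSpace ℝ (Fin q)) (x : E) : MatSpace q E := WithLp.toLp 2 fun i => v i • x

/-- `matAct` as a linear map. -/
def matActLin (Γ : MatSpace q E) : E →ₗ[ℝ] EuclideanSpace ℝ (Fin q) where
  toFun := matAct Γ
  map_add' x y := by ext i; simp [matAct, inner_add_right]
  map_smul' c x := by ext i; simp [matAct, real_inner_smul_right]

lemma inner_matAct (v : EuclideanSpace ℝ (Fin q)) (Γ : MatSpace q E) (x : E) :
    ⟪v, matAct Γ x⟫ = ⟪Γ, rankOne v x⟫ := by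
  simp [PiLp.inner_apply, matAct, rankOne, real_inner_smul_right, mul_comm]

lemma inner_rankOne (v : EuclideanSpace ℝ (Fin q)) (x y : E) :
    ⟪rankOne v x, rankOne v y⟫ = ‖v‖ ^ 2 * ⟪x, y⟫ := by
  simp only [PiLp.inner_apply, rankOne, real_inner_smul_right, real_inner_smul_left,
    EuclideanSpace.norm_sq_eq, Finset.sum_mul, norm_eq_abs, sq_abs]
  exact Finset.sum_congr rfl fun i _ => by ring

lemma norm_rankOne (v : EuclideanSpace ℝ (Fin q)) (x : E) : ‖rankOne v x‖ = ‖v‖ * ‖x‖ := by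
  rw [← sq_eq_sq₀ (norm_nonneg _) (by positivity), ← real_inner_self_eq_norm_sq, inner_rankOne,
    real_inner_self_eq_norm_sq]
  ring

lemma matAct_smul (Γ : MatSpace q E) (c : ℝ) (x : E) : matAct Γ (c • x) = c • matAct Γ x :=
  (matActLin Γ).map_smul c x

lemma continuous_matAct : Continuous fun z : MatSpace q E × E => matAct z.1 z.2 := by
  unfold matAct
  fun_prop

lemma exists_mem_net_half_le {N : Finset (EuclideanSpace ℝ (Fin q))} {ε : ℝ} (hε : ε ≤ 1 / 2)
    (hN : ∀ x : EuclideanSpace ℝ (Fin q), ‖x‖ = 1 → ∃ v ∈ N, dist x v ≤ ε)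
    {z : EuclideanSpace ℝ (Fin q)} (hz : z ≠ 0) : ∃ v ∈ N, ‖z‖ / 2 ≤ ⟪v, z⟫ := by
  have hz' : 0 < ‖z‖ := norm_pos_iff.2 hz
  obtain ⟨v, hv, hd⟩ := hN (‖z‖⁻¹ • z) (by rw [norm_smul]; simp [hz'.ne'])
  refine ⟨v, hv, ?_⟩
  have h1 : ⟪‖z‖⁻¹ • z - v, z⟫ ≤ ‖‖z‖⁻¹ • z - v‖ * ‖z‖ := real_inner_le_norm _ _
  rw [← dist_eq_norm, inner_sub_left, real_inner_smul_left, real_inner_self_eq_norm_sq] at h1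
  have h2 : ‖z‖⁻¹ * ‖z‖ ^ 2 = ‖z‖ := by field_simp
  nlinarith

variable [FiniteDimensional ℝ E] [MeasurableSpace E] [BorelSpace E]

lemma gauss_norm_matAct_le {N : Finset (EuclideanSpace ℝ (Fin q))} {ε : ℝ} (hε : ε ≤ 1 / 2)
    (hN1 : ∀ v ∈ N, ‖v‖ = 1)
    (hN : ∀ x : EuclideanSpace ℝ (Fin q), ‖x‖ = 1 → ∃ v ∈ N, dist x v ≤ ε) {a : ℝ} (ha : 0 ≤ a)
    (x : E) : (gauss (MatSpace q E)).real {Γ | a * ‖x‖ < ‖matAct Γ x‖} ≤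
      N.card * exp (-(a ^ 2 / 8)) := by
  by_cases hx : x = 0
  · have : {Γ : MatSpace q E | a * ‖x‖ < ‖matAct Γ x‖} = ∅ := by
      ext Γ
      have : matAct Γ x = 0 := by rw [hx]; exact (matActLin Γ).map_zero
      simp [hx]
      simpa [hx] using this
    rw [this]; simp; positivity
  have hx' : 0 < ‖x‖ := norm_pos_iff.2 hx
  let h : EuclideanSpace ℝ (Fin q) → MatSpace q E := fun v => (a / 2 / ‖x‖) • rankOne v x
  have hh : ∀ v ∈ N, ‖h v‖ = a / 2 := by
    intro v hv
    rw [norm_smul, norm_rankOne, hN1 v hv, Real.norm_of_nonneg (by positivity)]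
    field_simp
  have hsub : {Γ : MatSpace q E | a * ‖x‖ < ‖matAct Γ x‖} ⊆
      ⋃ v ∈ N, {Γ | ‖h v‖ ^ 2 ≤ ⟪Γ, h v⟫} := by
    intro Γ (hΓ : a * ‖x‖ < ‖matAct Γ x‖)
    have hz : matAct Γ x ≠ 0 := norm_pos_iff.1 (lt_of_le_of_lt (by positivity) hΓ)
    obtain ⟨v, hv, hvz⟩ := exists_mem_net_half_le hε hN hz
    refine Set.mem_biUnion hv ?_
    change ‖h v‖ ^ 2 ≤ ⟪Γ, h v⟫
    rw [hh v hv, real_inner_smul_right, ← inner_matAct]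
    have : a * ‖x‖ / 2 ≤ ⟪v, matAct Γ x⟫ := by linarith
    calc (a / 2) ^ 2 = a / 2 / ‖x‖ * (a * ‖x‖ / 2) := by field_simp
      _ ≤ _ := by gcongr
  calc _ ≤ (gauss (MatSpace q E)).real (⋃ v ∈ N, {Γ | ‖h v‖ ^ 2 ≤ ⟪Γ, h v⟫}) :=
        measureReal_mono hsub (measure_ne_top _ _)
    _ ≤ ∑ v ∈ N, (gauss (MatSpace q E)).real {Γ | ‖h v‖ ^ 2 ≤ ⟪Γ, h v⟫} :=
        measureReal_biUnion_finset_le _ _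
    _ ≤ ∑ v ∈ N, exp (-(a ^ 2 / 8)) := by
        refine Finset.sum_le_sum fun v hv => (gauss_halfspace_le (h v)).trans_eq ?_
        rw [hh v hv]; congr 2; ring
    _ = _ := by simp

/-- Shifting a large set of matrices by a multiple of `v ⊗ θ`: the `ν`-tail of `⟪v, Γ x⟫` barely
changes while `⟪v, Γ θ⟫` becomes large. -/
lemma exists_large_shift {G : Set (MatSpace q E)}
    (hGm : MeasurableSet G) {b g : ℝ} (hb : 0 ≤ b)
    (hg : g + 2 * exp (-(b ^ 2 / 8)) ≤ (gauss (MatSpace q E)).real G)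
    {v : EuclideanSpace ℝ (Fin q)} (hv : ‖v‖ = 1) {θ : E} (hθ : ‖θ‖ = 1)
    {U : Set (MatSpace q E)} (hU : MeasurableSet U)
    (hGU : ∀ Γ ∈ G, b / 2 ≤ ⟪Γ + b • rankOne v θ, rankOne v θ⟫ → Γ + b • rankOne v θ ∈ U) :
    exp (-b ^ 2) * g ≤ (gauss (MatSpace q E)).real U := by
  set γ := gauss (MatSpace q E)
  set w := rankOne v θ with hw
  have hwn : ‖w‖ = 1 := by rw [hw, norm_rankOne, hv, hθ, one_mul]
  let T : Set (MatSpace q E) := {Γ | b / 2 ≤ ⟪Γ, w⟫}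
  let T' : Set (MatSpace q E) := {Γ | b / 2 ≤ ⟪Γ, -w⟫}
  have hTm : MeasurableSet T := (isClosed_le (by fun_prop) (by fun_prop)).measurableSet
  have hTm' : MeasurableSet T' := (isClosed_le (by fun_prop) (by fun_prop)).measurableSet
  have htail : ∀ w' : MatSpace q E, ‖w'‖ = 1 →
      γ.real {Γ | b / 2 ≤ ⟪Γ, w'⟫} ≤ exp (-(b ^ 2 / 8)) := by
    intro w' hw'
    have hn : ‖(b / 2) • w'‖ = b / 2 := by
      rw [norm_smul, hw', mul_one, Real.norm_of_nonneg (by positivity)]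
    have h1 := gauss_halfspace_le ((b / 2) • w')
    rw [hn, show (b / 2) ^ 2 / 2 = b ^ 2 / 8 by ring] at h1
    refine (measureReal_mono ?_).trans h1
    intro Γ (hΓ : b / 2 ≤ ⟪Γ, w'⟫)
    change (b / 2) ^ 2 ≤ ⟪Γ, (b / 2) • w'⟫
    rw [real_inner_smul_right, sq]
    gcongr
  have hT := htail w hwn
  have hT' := htail (-w) (by rw [norm_neg, hwn])
  have hS : g ≤ γ.real (G \ (T ∪ T')) := by
    have h1 : γ.real G ≤ γ.real (G \ (T ∪ T')) + γ.real (T ∪ T') := by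
      refine (measureReal_mono ?_).trans (measureReal_union_le _ _)
      intro Γ hΓ
      by_cases h : Γ ∈ T ∪ T'
      exacts [Or.inr h, Or.inl ⟨hΓ, h⟩]
    have h2 := measureReal_union_le (μ := γ) T T'
    linarith
  refine (mul_le_mul_of_nonneg_left hS (exp_pos _).le).trans ?_
  refine exp_mul_gauss_le (b • w) (-b ^ 2) (hGm.diff (hTm.union hTm')) hU ?_ ?_
  · rintro Γ ⟨hΓ, hΓT⟩
    refine hGU Γ hΓ ?_
    have h1 : ¬ (b / 2 ≤ ⟪Γ, -w⟫) := fun h => hΓT (Or.inr h)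
    rw [inner_neg_right] at h1
    rw [inner_add_left, real_inner_smul_left, real_inner_self_eq_norm_sq, hwn]
    linarith
  · rintro Γ ⟨hΓ, hΓT⟩
    have h1 : ¬ (b / 2 ≤ ⟪Γ, w⟫) := fun h => hΓT (Or.inl h)
    rw [real_inner_smul_right, norm_smul, hwn, Real.norm_of_nonneg hb]
    nlinarith

end

section

variable {E : Type*} [NormedAddCommGroup E] [InnerProductSpace ℝ E] [FiniteDimensional ℝ E]
  [MeasurableSpace E] [BorelSpace E]

/-- With substantial probability a Gaussian matrix does not enlarge most vectors. -/
lemma half_le_gauss_good {ν : Measure E} [IsProbabilityMeasure ν] {q : ℕ} (hq : 1 ≤ q)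
    {N : Finset (EuclideanSpace ℝ (Fin q))} {ε : ℝ} (hε : ε ≤ 1 / 2)
    (hN1 : ∀ v ∈ N, ‖v‖ = 1)
    (hN : ∀ x : EuclideanSpace ℝ (Fin q), ‖x‖ = 1 → ∃ v ∈ N, dist x v ≤ ε)
    (hcard : (N.card : ℝ) ≤ exp (25 * q)) :
    1 / 2 ≤ (gauss (MatSpace q E)).real
      {Γ | ν.real {x | 48 * √q * ‖x‖ < ‖matAct Γ x‖} ≤ exp (-(256 * q))} := by
  have hq' : (1 : ℝ) ≤ q := by exact_mod_cast hq
  set γ := gauss (MatSpace q E)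
  let S : Set (E × MatSpace q E) := {z | 48 * √q * ‖z.1‖ < ‖matAct z.2 z.1‖}
  have hSm : MeasurableSet S := by
    refine (isOpen_lt (by fun_prop) ?_).measurableSet
    exact (continuous_matAct.comp continuous_swap).norm
  let G : Set (MatSpace q E) :=
    {Γ | ν.real {x | 48 * √q * ‖x‖ < ‖matAct Γ x‖} ≤ exp (-(256 * q))}
  have hGm : MeasurableSet G := by
    refine measurableSet_le ?_ measurable_const
    exact (measurable_measure_prodMk_right hSm).ennreal_toReal
  have h1 := mul_measureReal_le_of_slices (γ := ν) (ν := γ) hSm (η := exp (25 * q) * exp (-(288 * q)))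
    (κ := exp (-(256 * q))) (B := Gᶜ) (by positivity) ?_ ?_
  · rw [probReal_compl_eq_one_sub hGm, ← exp_add] at h1
    have h2 : exp (25 * q + -(288 * q)) ≤ exp (-(256 * q)) * (1 / 2) := by
      rw [show (25 * q + -(288 * q) : ℝ) = -(256 * q) + -(7 * q) by ring, exp_add]
      gcongr
      rw [exp_neg, one_div]
      gcongr
      linarith [add_one_le_exp (7 * q : ℝ)]
    have h3 := le_of_mul_le_mul_left (h1.trans h2) (exp_pos _)
    change 1 / 2 ≤ γ.real G
    linarith
  · intro x
    refine (gauss_norm_matAct_le hε hN1 hN (a := 48 * √q) (by positivity) x).trans ?_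
    gcongr
    rw [mul_pow, Real.sq_sqrt (by positivity)]
    linarith
  · intro Γ hΓ
    have hΓ' : ¬ ν.real {x | 48 * √q * ‖x‖ < ‖matAct Γ x‖} ≤ exp (-(256 * q)) := hΓ
    exact (not_le.1 hΓ').le

/-- The constant controlling the direction found in the image of a Gaussian matrix. -/
def dirConst : ℝ := (2 * exp 259 + 1) * 48

lemma dirConst_pos : 0 < dirConst := by unfold dirConst; positivity

/-- For a good matrix some net direction has small tails. -/
lemma exists_mem_net_tail_le {ν : Measure E} [IsProbabilityMeasure ν] (hν : LogConcaveMeasure ν)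
    {q : ℕ} (hq : 1 ≤ q) {N : Finset (EuclideanSpace ℝ (Fin q))} {ε M : ℝ} (hM : 1 ≤ M)
    (hε0 : 0 ≤ ε) (hε : ε * 48 * 4096 ≤ 1)
    (hN : ∀ x : EuclideanSpace ℝ (Fin q), ‖x‖ = 1 → ∃ v ∈ N, dist x v ≤ ε)
    (h1 : ν.real {x | 1 < ‖x‖} ≤ 1 / 8)
    (h2 : ν.real {x | 4096 * M ≤ ‖x‖} ≤ exp (-(256 * q)))
    {Γ : MatSpace q E} (hΓ : ν.real {x | 48 * √q * ‖x‖ < ‖matAct Γ x‖} ≤ exp (-(256 * q))) :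
    ∃ v ∈ N, ν.real {x | (dirConst + M) * √q ≤ ⟪v, matAct Γ x⟫} ≤ 3 * exp (-(256 * q)) := by
  have hq' : (1 : ℝ) ≤ q := by exact_mod_cast hq
  have hsq : 0 < √(q : ℝ) := Real.sqrt_pos.2 (by linarith)
  let T : E →L[ℝ] EuclideanSpace ℝ (Fin q) := LinearMap.toContinuousLinearMap (matActLin Γ)
  have hT : ∀ x, T x = matAct Γ x := fun x => rfl
  have hTm : Measurable T := T.continuous.measurable
  have : IsProbabilityMeasure (ν.map T) := Measure.isProbabilityMeasure_map hTm.aemeasurable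
  have hball : 1 / 2 ≤ (ν.map T).real (Metric.closedBall 0 (48 * √q)) := by
    have hc : (ν.map T).real (Metric.closedBall 0 (48 * √q))ᶜ ≤ 1 / 2 := by
      rw [map_measureReal_apply hTm measurableSet_closedBall.compl]
      have hsub : T ⁻¹' (Metric.closedBall 0 (48 * √q))ᶜ ⊆
          {x | 1 < ‖x‖} ∪ {x | 48 * √q * ‖x‖ < ‖matAct Γ x‖} := by
        intro x hx
        by_cases hx1 : 1 < ‖x‖
        · exact Or.inl hx1
        · right
          have : 48 * √q < ‖matAct Γ x‖ := by simpa [hT] using hx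
          change 48 * √q * ‖x‖ < ‖matAct Γ x‖
          push Not at hx1
          nlinarith
      have h3 := (measureReal_mono hsub (measure_ne_top ν _)).trans (measureReal_union_le _ _)
      have h4 : exp (-(256 * q : ℝ)) ≤ 3 / 8 := by
        rw [exp_neg]
        refine inv_le_of_inv_le₀ (by norm_num) ?_
        linarith [add_one_le_exp (256 * q : ℝ)]
      linarith
    rw [probReal_compl_eq_one_sub measurableSet_closedBall] at hc
    linarith
  obtain ⟨w, hw, hwt⟩ := (hν.map T).exists_direction (c := 258) (r := 48 * √q)
    (by simpa using hq) (by positivity) hball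
  simp only [finrank_euclideanSpace, Fintype.card_fin] at hwt
  rw [map_measureReal_apply hTm (isClosed_le (by fun_prop) (by fun_prop)).measurableSet] at hwt
  obtain ⟨v, hv, hd⟩ := hN w hw
  refine ⟨v, hv, ?_⟩
  have hsub : {x | (dirConst + M) * √q ≤ ⟪v, matAct Γ x⟫} ⊆
      (T ⁻¹' {y | (2 * exp (258 + 1) + 1) * (48 * √q) ≤ ⟪w, y⟫} ∪ {x | 4096 * M ≤ ‖x‖}) ∪
        {x | 48 * √q * ‖x‖ < ‖matAct Γ x‖} := by
    intro x (hx : (dirConst + M) * √q ≤ ⟪v, matAct Γ x⟫)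
    by_cases hx1 : 48 * √q * ‖x‖ < ‖matAct Γ x‖
    · exact Or.inr hx1
    by_cases hx2 : 4096 * M ≤ ‖x‖
    · exact Or.inl (Or.inr hx2)
    refine Or.inl (Or.inl ?_)
    change (2 * exp (258 + 1) + 1) * (48 * √q) ≤ ⟪w, matAct Γ x⟫
    push Not at hx1 hx2
    have h3 : ⟪v - w, matAct Γ x⟫ ≤ ‖v - w‖ * ‖matAct Γ x‖ := real_inner_le_norm _ _
    rw [← dist_eq_norm, dist_comm, inner_sub_left] at h3
    have h4 : dist w v * ‖matAct Γ x‖ ≤ ε * (48 * √q * (4096 * M)) := by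
      gcongr
      exact hx1.trans (by gcongr)
    have h5 : ε * (48 * √q * (4096 * M)) ≤ M * √q := by
      have : 0 ≤ M * √q := by positivity
      nlinarith
    have h6 : dirConst * √q = (2 * exp (258 + 1) + 1) * (48 * √q) := by
      unfold dirConst; norm_num; ring
    linarith
  have h3 := (measureReal_mono hsub (measure_ne_top ν _)).trans (measureReal_union_le _ _)
  have h4 := measureReal_union_le (μ := ν)
    (T ⁻¹' {y | (2 * exp (258 + 1) + 1) * (48 * √q) ≤ ⟪w, y⟫}) {x | 4096 * M ≤ ‖x‖}
  have h5 : (2 : ℝ) ^ q * (2 * exp (-(258 * q))) ≤ exp (-(256 * q)) := by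
    have h6 : (2 : ℝ) ^ q ≤ exp q := by
      rw [← mul_one (q : ℝ), exp_nat_mul]
      gcongr
      linarith [add_one_le_exp (1 : ℝ)]
    have h7 : 2 ≤ exp (q : ℝ) := by linarith [add_one_le_exp (q : ℝ)]
    calc (2 : ℝ) ^ q * (2 * exp (-(258 * q))) ≤ exp q * (exp q * exp (-(258 * q))) := by gcongr
      _ = exp (-(256 * q)) := by rw [← exp_add, ← exp_add]; congr 1; ring
  linarith

/-- Large deviations of the norm, provided the next scale is already under control. -/
lemma norm_tail_le_of_next_scale {ν : Measure E} [IsProbabilityMeasure ν]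
    (hν : LogConcaveMeasure ν) {q : ℕ} (hq : 1 ≤ q) {M : ℝ}
    (hM : dirConst + 15 * 2048 ≤ M)
    (h1 : ν.real {x | 1 < ‖x‖} ≤ 1 / 8)
    (h2 : ν.real {x | 4096 * M ≤ ‖x‖} ≤ exp (-(256 * q)))
    (h3 : ∀ θ : E, ‖θ‖ = 1 → ν.real {x | 2048 ≤ ⟪θ, x⟫} ≤ exp (-(256 * q))) :
    ν.real {x | M ≤ ‖x‖} ≤ exp (-q) := by
  have hq' : (1 : ℝ) ≤ q := by exact_mod_cast hq
  have hM1 : 1 ≤ M := by linarith [dirConst_pos]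
  have hsq : 0 < √(q : ℝ) := Real.sqrt_pos.2 (by linarith)
  have hsq2 : √(q : ℝ) ^ 2 = q := Real.sq_sqrt (by linarith)
  obtain ⟨N, hN1, hN, hcard⟩ := exists_finset_net (E := EuclideanSpace ℝ (Fin q))
    (δ := (2 : ℝ)⁻¹ ^ 31) (by positivity)
  have hcard' : (N.card : ℝ) ≤ exp (25 * q) := by
    rw [finrank_euclideanSpace, Fintype.card_fin] at hcard
    refine hcard.trans ?_
    rw [mul_comm (25 : ℝ), exp_nat_mul]
    gcongr
    have h4 : (2.7 : ℝ) ≤ exp 1 := by linarith [Real.exp_one_gt_d9]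
    calc (1 + ((2 : ℝ)⁻¹ ^ 31)⁻¹) ≤ 2.7 ^ 25 := by norm_num
      _ ≤ exp 1 ^ 25 := by gcongr
      _ = exp 25 := by rw [← exp_nat_mul]; norm_num
  set γ := gauss (MatSpace q E)
  let G : EuclideanSpace ℝ (Fin q) → Set (MatSpace q E) := fun v =>
    {Γ | ν.real {x | (dirConst + M) * √q ≤ ⟪v, matAct Γ x⟫} ≤ 3 * exp (-(256 * q))}
  let S : EuclideanSpace ℝ (Fin q) → ℝ → Set (MatSpace q E × E) := fun v a =>
    {z | a * √q ≤ ⟪v, matAct z.1 z.2⟫}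
  have hS : ∀ v a, MeasurableSet (S v a) := fun v a =>
    (isClosed_le (by fun_prop) (continuous_const.inner continuous_matAct)).measurableSet
  have hGm : ∀ v, MeasurableSet (G v) := fun v =>
    measurableSet_le (measurable_measure_prodMk_left (hS v _)).ennreal_toReal measurable_const
  obtain ⟨v, hvN, hv⟩ : ∃ v ∈ N, 1 / 2 * exp (-(25 * q)) ≤ γ.real (G v) := by
    by_contra! hlt
    have hgood := half_le_gauss_good (E := E) (ν := ν) hq (ε := 2 * (2 : ℝ)⁻¹ ^ 31) (by norm_num)
      hN1 hN hcard'
    have hsub : {Γ : MatSpace q E | ν.real {x | 48 * √q * ‖x‖ < ‖matAct Γ x‖} ≤ exp (-(256 * q))} ⊆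
        ⋃ v ∈ N, G v := by
      intro Γ hΓ
      obtain ⟨v, hv, h⟩ := exists_mem_net_tail_le hν hq hM1 (by positivity) (by norm_num) hN h1 h2 hΓ
      exact Set.mem_biUnion hv h
    have h4 : 1 / 2 ≤ ∑ v ∈ N, γ.real (G v) :=
      hgood.trans ((measureReal_mono hsub (measure_ne_top _ _)).trans
        (measureReal_biUnion_finset_le _ _))
    have hNne : N.Nonempty := by
      rw [Finset.nonempty_iff_ne_empty]
      rintro rfl
      norm_num at h4
    have h5 := Finset.sum_lt_sum_of_nonempty hNne hlt
    rw [Finset.sum_const, nsmul_eq_mul] at h5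
    have h6 : (N.card : ℝ) * (1 / 2 * exp (-(25 * q))) ≤ exp (25 * q) * (1 / 2 * exp (-(25 * q))) := by
      gcongr
    have h7 : exp (25 * q : ℝ) * exp (-(25 * q)) = 1 := by rw [← exp_add]; simp
    linarith
  have hv1 := hN1 v hvN
  let G' : Set (MatSpace q E) :=
    {Γ | ν.real {x | (dirConst + M + 15 * 2048) * √q ≤ ⟪v, matAct Γ x⟫} ≤ 4 * exp (-(256 * q))}
  have hGm' : MeasurableSet G' :=
    measurableSet_le (measurable_measure_prodMk_left (hS v _)).ennreal_toReal measurable_const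
  have hshift : ∀ x : E, M ≤ ‖x‖ → exp (-(15 * √q) ^ 2) * (1 / 4 * exp (-(25 * q))) ≤
      γ.real {Γ | Γ ∈ G' ∧ (dirConst + M + 15 * 2048) * √q ≤ ⟪v, matAct Γ x⟫} := by
    intro x hx
    have hx0 : 0 < ‖x‖ := by linarith
    set θ := ‖x‖⁻¹ • x with hθ
    have hθ1 : ‖θ‖ = 1 := by rw [hθ, norm_smul]; simp [hx0.ne']
    have hxθ : x = ‖x‖ • θ := by rw [hθ, smul_smul, mul_inv_cancel₀ hx0.ne', one_smul]
    refine exists_large_shift (hGm v) (b := 15 * √q) (by positivity) ?_ hv1 hθ1 ?_ ?_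
    · refine le_trans ?_ hv
      rw [mul_pow, hsq2]
      have h4 : exp (-(15 ^ 2 * q / 8)) ≤ exp (-(25 * q)) * (1 / 8) := by
        rw [show (-(15 ^ 2 * q / 8) : ℝ) = -(25 * q) + -(25 / 8 * q) by ring, exp_add]
        gcongr
        rw [exp_neg, one_div]
        gcongr
        have h5 : (2.7 : ℝ) ≤ exp 1 := by linarith [Real.exp_one_gt_d9]
        calc (8 : ℝ) ≤ 2.7 ^ 3 := by norm_num
          _ ≤ exp 1 ^ 3 := by gcongr
          _ = exp 3 := by rw [← exp_nat_mul]; norm_num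
          _ ≤ exp (25 / 8 * q) := by gcongr; linarith
      linarith
    · have hc : Continuous fun Γ : MatSpace q E => ⟪v, matAct Γ x⟫ := continuous_const.inner
        (continuous_matAct.comp (by fun_prop : Continuous fun Γ : MatSpace q E => (Γ, x)))
      exact hGm'.inter (isClosed_le continuous_const hc).measurableSet
    · intro Γ hΓ hb
      constructor
      · have hsub : {y | (dirConst + M + 15 * 2048) * √q ≤
            ⟪v, matAct (Γ + (15 * √q) • rankOne v θ) y⟫} ⊆
            {y | (dirConst + M) * √q ≤ ⟪v, matAct Γ y⟫} ∪ {y | 2048 ≤ ⟪θ, y⟫} := by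
          intro y hy
          have hy : (dirConst + M + 15 * 2048) * √q ≤
            ⟪v, matAct (Γ + (15 * √q) • rankOne v θ) y⟫ := hy
          by_cases hy2 : 2048 ≤ ⟪θ, y⟫
          · exact Or.inr hy2
          · left
            change (dirConst + M) * √q ≤ ⟪v, matAct Γ y⟫
            rw [inner_matAct, inner_add_left, real_inner_smul_left, inner_rankOne, hv1,
              ← inner_matAct] at hy
            push Not at hy2
            nlinarith
        have h4 := (measureReal_mono hsub (measure_ne_top ν _)).trans (measureReal_union_le _ _)
        have h5 := h3 θ hθ1
        have h6 : ν.real {y | (dirConst + M) * √q ≤ ⟪v, matAct Γ y⟫} ≤ 3 * exp (-(256 * q)) := hΓ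
        change ν.real _ ≤ _
        linarith
      · rw [hxθ, matAct_smul, real_inner_smul_right, inner_matAct]
        calc (dirConst + M + 15 * 2048) * √q ≤ M * (15 * √q / 2) := by nlinarith
          _ ≤ _ := by gcongr
  have hfin := mul_measureReal_le_of_slices (γ := γ) (ν := ν)
    (S := (Prod.fst ⁻¹' G') ∩ S v (dirConst + M + 15 * 2048))
    ((hGm'.preimage measurable_fst).inter (hS v _)) (η := 4 * exp (-(256 * q)))
    (B := {x | M ≤ ‖x‖}) (by positivity) ?_ (fun x hx => hshift x hx)
  · rw [mul_pow, hsq2] at hfin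
    have h4 : 4 * exp (-(256 * q)) ≤ exp (-(15 ^ 2 * q)) * (1 / 4 * exp (-(25 * q))) * exp (-q : ℝ) := by
      have h5 : exp (-(256 * q) : ℝ) = exp (-(15 ^ 2 * q)) * exp (-(25 * q)) * exp (-q : ℝ) * exp (-(5 * q)) := by
        rw [← exp_add, ← exp_add, ← exp_add]; congr 1; ring
      have h6 : exp (-(5 * q) : ℝ) ≤ 1 / 16 := by
        rw [exp_neg, one_div]
        gcongr
        have h5 : (2.7 : ℝ) ≤ exp 1 := by linarith [Real.exp_one_gt_d9]
        calc (16 : ℝ) ≤ 2.7 ^ 5 := by norm_num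
          _ ≤ exp 1 ^ 5 := by gcongr
          _ = exp 5 := by rw [← exp_nat_mul]; norm_num
          _ ≤ exp (5 * q) := by gcongr; linarith
      rw [h5]
      have h7 : 0 ≤ exp (-(15 ^ 2 * q) : ℝ) * exp (-(25 * q)) * exp (-q : ℝ) := by positivity
      have h8 := mul_le_mul_of_nonneg_left h6 h7
      linarith
    exact le_of_mul_le_mul_left (hfin.trans h4) (by positivity)
  · intro Γ
    by_cases hΓ : Γ ∈ G'
    · refine (measureReal_mono ?_ (measure_ne_top ν _)).trans hΓ
      exact fun x hx => hx.2
    · have : {y | (Γ, y) ∈ (Prod.fst ⁻¹' G') ∩ S v (dirConst + M + 15 * 2048)} = ∅ := by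
        ext y; simp [hΓ]
      rw [this]; simp; positivity

/-- The constant in the norm deviation inequality. -/
def normConst : ℝ := dirConst + 15 * 2048

lemma one_le_normConst : 1 ≤ normConst := by unfold normConst; linarith [dirConst_pos]

/-- A Paouris type deviation inequality. -/
lemma LogConcaveMeasure.norm_tail_le {ν : Measure E} [IsProbabilityMeasure ν]
    (hν : LogConcaveMeasure ν) {p : ℝ} (hp : 1 ≤ p)
    (h1 : ν.real {x | 1 < ‖x‖} ≤ 1 / 8)
    (h2 : ∀ θ : E, ‖θ‖ = 1 → ν.real {x | 1 ≤ |⟪θ, x⟫|} ≤ exp (-p)) :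
    ν.real {x | normConst ≤ ‖x‖} ≤ exp (-p) := by
  have hC0 : 0 < normConst := by linarith [one_le_normConst]
  by_contra! hlt
  obtain ⟨M, hCM, hM2, hM⟩ := exists_dyadic_scale ν (f := fun x : E => ‖x‖) (by fun_prop) hC0
    (exp_pos (-p))
  have hlow : exp (-p) < ν.real {x | M ≤ ‖x‖} := by
    rcases hM with rfl | hM
    exacts [hlt, hM.2]
  set q := ⌈p⌉₊
  have hqp : p ≤ q := Nat.le_ceil p
  have hq2 : (q : ℝ) ≤ 2 * p := by
    have := Nat.ceil_lt_add_one (a := p) (by linarith)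
    linarith
  have hq1 : 1 ≤ q := Nat.one_le_ceil_iff.2 (by linarith)
  have hfin := norm_tail_le_of_next_scale hν hq1 hCM h1 ?_ ?_
  · have : exp (-(q : ℝ)) ≤ exp (-p) := by gcongr
    linarith
  · have h3 := hν.tail_le (ContinuousLinearMap.id ℝ E) hp (t := 2048) (by norm_num) hM2
    simp only [ContinuousLinearMap.id_apply] at h3
    rw [← mul_assoc, show (2048 * 2 : ℝ) = 4096 by norm_num] at h3
    refine h3.trans (exp_le_exp.2 ?_)
    linarith
  · intro θ hθ
    have h3 := hν.tail_le (innerSL ℝ θ) hp (t := 2048) (by norm_num) (r := 1) (h2 θ hθ)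
    refine (measureReal_mono ?_ (measure_ne_top _ _)).trans (h3.trans (exp_le_exp.2 ?_))
    · intro x (hx : 2048 ≤ ⟪θ, x⟫)
      change 2048 * 1 ≤ |⟪θ, x⟫|
      rw [mul_one]
      exact hx.trans (le_abs_self _)
    · linarith

end

/-- The coordinate projection onto the span of the basis vectors indexed by `K`. -/
def coordProj {n : ℕ} (K : Finset (Fin n)) :
    EuclideanSpace ℝ (Fin n) →L[ℝ] EuclideanSpace ℝ (Fin n) :=
  LinearMap.toContinuousLinearMap
    { toFun := fun x => WithLp.toLp 2 fun i => if i ∈ K then x i else 0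
      map_add' := fun x y => by
        ext i; by_cases h : i ∈ K <;> simp [h]
      map_smul' := fun c x => by
        ext i; by_cases h : i ∈ K <;> simp [h] }

lemma coordProj_apply {n : ℕ} (K : Finset (Fin n)) (x : EuclideanSpace ℝ (Fin n)) (i : Fin n) :
    coordProj K x i = if i ∈ K then x i else 0 := rfl

lemma norm_coordProj_sq {n : ℕ} (K : Finset (Fin n)) (x : EuclideanSpace ℝ (Fin n)) :
    ‖coordProj K x‖ ^ 2 = ∑ i ∈ K, x i ^ 2 := by
  simp [EuclideanSpace.norm_sq_eq, coordProj_apply, apply_ite, ite_pow, Finset.sum_ite_mem]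

lemma inner_coordProj {n : ℕ} (K : Finset (Fin n)) (θ x : EuclideanSpace ℝ (Fin n)) :
    ⟪θ, coordProj K x⟫ = ⟪coordProj K θ, x⟫ := by
  simp [PiLp.inner_apply, coordProj_apply]

lemma norm_coordProj_le {n : ℕ} (K : Finset (Fin n)) (x : EuclideanSpace ℝ (Fin n)) :
    ‖coordProj K x‖ ≤ ‖x‖ := by
  rw [← sq_le_sq₀ (norm_nonneg _) (norm_nonneg _), norm_coordProj_sq, EuclideanSpace.norm_sq_eq]
  simp only [norm_eq_abs, sq_abs]
  exact Finset.sum_le_sum_of_subset_of_nonneg (Finset.subset_univ K) fun i _ _ => sq_nonneg _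

section

variable {n : ℕ} {ν : Measure (EuclideanSpace ℝ (Fin n))} [IsProbabilityMeasure ν]

lemma LogConcaveMeasure.sum_sq_tail_le (hν : LogConcaveMeasure ν) {p r : ℝ} (hp : 1 ≤ p)
    (hr : 0 < r) (hM : ∀ K : Finset (Fin n), ν.real {x | 8 * K.card < ∑ i ∈ K, x i ^ 2} ≤ 1 / 8)
    (hW : ∀ θ : EuclideanSpace ℝ (Fin n), ‖θ‖ = 1 → ν.real {x | r ≤ |⟪θ, x⟫|} ≤ exp (-p))
    (K : Finset (Fin n)) :
    ν.real {x | normConst ^ 2 * (8 * K.card + 256 * r ^ 2) ≤ ∑ i ∈ K, x i ^ 2} ≤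
      exp (-(4 * p)) := by
  set R := √(8 * K.card + 256 * r ^ 2) with hR
  have hR2 : R ^ 2 = 8 * K.card + 256 * r ^ 2 := Real.sq_sqrt (by positivity)
  have hR0 : 0 < R := Real.sqrt_pos.2 (by positivity)
  have hRr : 16 * r ≤ R := Real.le_sqrt_of_sq_le (by nlinarith [K.card.cast_nonneg (α := ℝ)])
  let T := R⁻¹ • coordProj K
  have hTn : ∀ x, ‖T x‖ ^ 2 = (∑ i ∈ K, x i ^ 2) / R ^ 2 := by
    intro x
    rw [← norm_coordProj_sq]
    simp [T, norm_smul, mul_pow, abs_of_pos hR0]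
    ring
  have hTm : Measurable T := T.continuous.measurable
  have : IsProbabilityMeasure (ν.map T) := Measure.isProbabilityMeasure_map hTm.aemeasurable
  have key := (hν.map T).norm_tail_le (p := 4 * p) (by linarith) ?_ ?_
  · rw [map_measureReal_apply hTm (isClosed_le (by fun_prop) (by fun_prop)).measurableSet] at key
    refine (measureReal_mono ?_ (measure_ne_top _ _)).trans key
    intro x (hx : normConst ^ 2 * (8 * K.card + 256 * r ^ 2) ≤ ∑ i ∈ K, x i ^ 2)
    change normConst ≤ ‖T x‖
    rw [← sq_le_sq₀ (by linarith [one_le_normConst]) (norm_nonneg _), hTn,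
      le_div_iff₀ (by positivity), hR2]
    exact hx
  · rw [map_measureReal_apply hTm (isOpen_lt (by fun_prop) (by fun_prop)).measurableSet]
    refine (measureReal_mono ?_ (measure_ne_top _ _)).trans (hM K)
    intro x (hx : 1 < ‖T x‖)
    change 8 * K.card < ∑ i ∈ K, x i ^ 2
    rw [← sq_lt_sq₀ zero_le_one (norm_nonneg _), hTn, one_pow, lt_div_iff₀ (by positivity), hR2]
      at hx
    nlinarith
  · intro θ hθ
    rw [map_measureReal_apply hTm (isClosed_le (by fun_prop) (by fun_prop)).measurableSet]
    by_cases h0 : coordProj K θ = 0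
    · have : T ⁻¹' {x | 1 ≤ |⟪θ, x⟫|} = ∅ := by
        ext x
        simp [T, real_inner_smul_right, inner_coordProj, h0]
      rw [this]; simp; positivity
    · have hn : 0 < ‖coordProj K θ‖ := norm_pos_iff.2 h0
      have hn1 : ‖coordProj K θ‖ ≤ 1 := (norm_coordProj_le K θ).trans hθ.le
      have h1 := hν.tail_le (innerSL ℝ (‖coordProj K θ‖⁻¹ • coordProj K θ)) hp (t := 16)
        (by norm_num) (r := r) (hW _ (by rw [norm_smul]; simp [hn.ne']))
      rw [show p * 16 / 4 = 4 * p by ring] at h1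
      refine (measureReal_mono ?_ (measure_ne_top _ _)).trans h1
      intro x (hx : 1 ≤ |⟪θ, T x⟫|)
      change 16 * r ≤ |⟪‖coordProj K θ‖⁻¹ • coordProj K θ, x⟫|
      rw [real_inner_smul_left, abs_mul, abs_of_pos (by positivity)]
      have hx' : R ≤ |⟪coordProj K θ, x⟫| := by
        change 1 ≤ |⟪θ, R⁻¹ • coordProj K x⟫| at hx
        rw [real_inner_smul_right, inner_coordProj, abs_mul, abs_of_pos (by positivity),
          inv_mul_eq_div, le_div_iff₀ hR0] at hx
        linarith
      calc 16 * r ≤ 1 * |⟪coordProj K θ, x⟫| := by linarith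
        _ ≤ _ := by
          gcongr
          exact (one_le_inv₀ hn).2 hn1

end

lemma sixth_le_measureReal_sum_indicator {α ι : Type*} [MeasurableSpace α] {ν : Measure α}
    [IsProbabilityMeasure ν] (K : Finset ι) {c : ι → ℝ} (hc : ∀ i ∈ K, 0 ≤ c i) {B : ι → Set α}
    (hB : ∀ i ∈ K, MeasurableSet (B i)) (hν : ∀ i ∈ K, 1 / 3 ≤ ν.real (B i)) :
    1 / 6 ≤ ν.real {x | (∑ i ∈ K, c i) / 6 ≤ ∑ i ∈ K, (B i).indicator (fun _ => c i) x} := by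
  set Q := ∑ i ∈ K, c i with hQ
  set f : α → ℝ := fun x => ∑ i ∈ K, (B i).indicator (fun _ => c i) x with hf
  have hQ0 : 0 ≤ Q := Finset.sum_nonneg hc
  have hfm : Measurable f := Finset.measurable_sum K fun i hi => measurable_const.indicator (hB i hi)
  let D : Set α := {x | Q / 6 ≤ f x}
  have hD : MeasurableSet D := measurableSet_le measurable_const hfm
  have hf0 : ∀ x, 0 ≤ f x := fun x => Finset.sum_nonneg fun i hi =>
    Set.indicator_nonneg (fun _ _ => hc i hi) x
  have hfQ : ∀ x, f x ≤ Q := fun x => Finset.sum_le_sum fun i hi =>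
    Set.indicator_le_self' (fun _ _ => hc i hi) x
  rcases hQ0.eq_or_lt with h0 | h0
  · have : {x | Q / 6 ≤ f x} = Set.univ := by
      ext x; simpa [← h0] using hf0 x
    rw [this, probReal_univ]; norm_num
  have h1 : ∫ x, f x ∂ν = ∑ i ∈ K, c i * ν.real (B i) := by
    rw [integral_finsetSum _ fun i hi => (integrable_const (c i)).indicator (hB i hi)]
    refine Finset.sum_congr rfl fun i hi => ?_
    rw [integral_indicator_const _ (hB i hi), smul_eq_mul, mul_comm]
  have h2 : Q / 3 ≤ ∫ x, f x ∂ν := by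
    rw [h1, hQ, Finset.sum_div]
    refine Finset.sum_le_sum fun i hi => ?_
    have := mul_le_mul_of_nonneg_left (hν i hi) (hc i hi)
    linarith
  have h3 : ∫ x, f x ∂ν ≤ ∫ x, (Q / 6 + D.indicator (fun _ => Q) x) ∂ν := by
    refine integral_mono (integrable_finsetSum _ fun i hi =>
      (integrable_const (c i)).indicator (hB i hi))
      ((integrable_const _).add ((integrable_const _).indicator hD)) fun x => ?_
    by_cases hx : x ∈ D
    · simp only [Set.indicator_of_mem hx]; linarith [hfQ x]
    · simp only [Set.indicator_of_notMem hx]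
      linarith [not_le.1 (show ¬ Q / 6 ≤ f x from hx)]
  rw [integral_add (integrable_const _) ((integrable_const _).indicator hD),
    integral_indicator_const _ hD] at h3
  simp only [integral_const, probReal_univ, smul_eq_mul, one_mul] at h3
  change 1 / 6 ≤ ν.real D
  nlinarith

section

variable {n : ℕ} {ν : Measure (EuclideanSpace ℝ (Fin n))} [IsProbabilityMeasure ν]

/-- Scales controlling the coordinate tails of a log-concave measure conditioned to a convex set
that is not too small. -/
lemma LogConcaveMeasure.exists_coord_scales (hν : LogConcaveMeasure ν) {p r : ℝ} (hp : 1 ≤ p)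
    (hr : 0 < r) (hM : ∀ K : Finset (Fin n), ν.real {x | 8 * K.card < ∑ i ∈ K, x i ^ 2} ≤ 1 / 8)
    (hW : ∀ θ : EuclideanSpace ℝ (Fin n), ‖θ‖ = 1 → ν.real {x | r ≤ |⟪θ, x⟫|} ≤ exp (-p))
    {A : Set (EuclideanSpace ℝ (Fin n))} (hA : MeasurableSet A) (hAc : Convex ℝ A)
    (hAp : exp (-(2 * p)) ≤ ν.real A) :
    ∃ (K : Finset (Fin n)) (β : Fin n → ℝ), (∀ i, 0 < β i) ∧
      (∀ i ∉ K, β i = 5 * normConst) ∧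
      (∀ i t, (ν[|A]).real {x | t ≤ |x i|} ≤ 2 * exp (-(t / (8 * β i)))) ∧
      ∑ i ∈ K, β i ^ 2 ≤ 3072 * normConst ^ 2 * r ^ 2 := by
  have hA0 : ν A ≠ 0 := fun h => by
    rw [measureReal_def, h] at hAp
    exact absurd hAp (not_le.2 (exp_pos _))
  have hprob : IsProbabilityMeasure (ν[|A]) := cond_isProbabilityMeasure hA0
  have hcond := hν.cond hA hAc
  have hC := one_le_normConst
  have hm : ∀ i : Fin n, Measurable fun x : EuclideanSpace ℝ (Fin n) => |x i| := fun i => by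
    fun_prop
  choose β hβC hβ2 hβ using fun i => exists_dyadic_scale (ν[|A]) (hm i) (C := 5 * normConst)
    (c := 1 / 3) (by linarith) (by norm_num)
  have hβ0 : ∀ i, 0 < β i := fun i => by linarith [hβC i]
  classical
  let K : Finset (Fin n) := Finset.univ.filter fun i => β i ≠ 5 * normConst
  have hK : ∀ i ∈ K, 2 * (5 * normConst) ≤ β i ∧ 1 / 3 < (ν[|A]).real {x | β i ≤ |x i|} :=
    fun i hi => (hβ i).resolve_left (by simpa [K] using hi)
  refine ⟨K, β, hβ0, fun i hi => by simpa [K] using hi, fun i t => ?_, ?_⟩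
  · rcases le_total t (2 * β i) with ht | ht
    · refine measureReal_le_one.trans ?_
      have h1 : t / (8 * β i) ≤ 1 / 4 := by
        rw [div_le_iff₀ (by linarith [hβ0 i])]; linarith
      linarith [add_one_le_exp (-(t / (8 * β i)))]
    · have h1 := hcond.tail_le (EuclideanSpace.proj i : EuclideanSpace ℝ (Fin n) →L[ℝ] ℝ)
        le_rfl (t := t / (2 * β i)) (by rw [one_le_div (by linarith [hβ0 i])]; exact ht)
        (r := 2 * β i) ((hβ2 i).trans ?_)
      · have h2 : t / (2 * β i) * (2 * β i) = t := by have := hβ0 i; field_simp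
        have h3 : 1 * (t / (2 * β i)) / 4 = t / (8 * β i) := by have := hβ0 i; field_simp; ring
        rw [h2, h3] at h1
        refine h1.trans ?_
        linarith [exp_pos (-(t / (8 * β i)))]
      · rw [exp_neg, one_div]
        gcongr
        exact exp_one_lt_three.le
  · by_contra! hlt
    have h1 := sixth_le_measureReal_sum_indicator (ν := ν[|A]) K (c := fun i => β i ^ 2)
      (fun i _ => sq_nonneg _) (B := fun i => {x | β i ≤ |x i|})
      (fun i _ => measurableSet_le measurable_const (hm i)) (fun i hi => (hK i hi).2.le)
    have hQK : 100 * normConst ^ 2 * K.card ≤ ∑ i ∈ K, β i ^ 2 := by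
      rw [mul_comm, ← nsmul_eq_mul]
      refine Finset.card_nsmul_le_sum _ _ _ fun i hi => ?_
      have := (hK i hi).1
      nlinarith
    have h2 : {x : EuclideanSpace ℝ (Fin n) | (∑ i ∈ K, β i ^ 2) / 6 ≤
        ∑ i ∈ K, {x : EuclideanSpace ℝ (Fin n) | β i ≤ |x i|}.indicator (fun _ => β i ^ 2) x} ⊆
        {x | normConst ^ 2 * (8 * K.card + 256 * r ^ 2) ≤ ∑ i ∈ K, x i ^ 2} := by
      intro x hx
      rw [Set.mem_ofPred_eq] at hx ⊢
      have h3 : ∑ i ∈ K, {x : EuclideanSpace ℝ (Fin n) | β i ≤ |x i|}.indicator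
          (fun _ => β i ^ 2) x ≤ ∑ i ∈ K, x i ^ 2 := by
        refine Finset.sum_le_sum fun i hi => ?_
        refine Set.indicator_apply_le' (fun h => ?_) fun _ => sq_nonneg _
        rw [← sq_abs (x i)]
        have := hβ0 i
        gcongr
        exact h
      have h4 : 0 ≤ ∑ i ∈ K, β i ^ 2 := Finset.sum_nonneg fun i _ => sq_nonneg _
      have h5 : normConst ^ 2 * (8 * K.card + 256 * r ^ 2) =
        8 * (normConst ^ 2 * K.card) + 256 * (normConst ^ 2 * r ^ 2) := by ring
      rw [h5]
      linarith
    set D : Set (EuclideanSpace ℝ (Fin n)) :=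
      {x | normConst ^ 2 * (8 * K.card + 256 * r ^ 2) ≤ ∑ i ∈ K, x i ^ 2}
    have h3 := h1.trans ((measureReal_mono h2 (measure_ne_top _ _)).trans_eq (measureReal_cond hA _))
    have h4 : ν.real (A ∩ D) ≤ exp (-(4 * p)) :=
      (measureReal_mono Set.inter_subset_right (measure_ne_top _ _)).trans
        (hν.sum_sq_tail_le hp hr hM hW K)
    have h5 : (ν.real A)⁻¹ * ν.real (A ∩ D) ≤ exp (2 * p) * exp (-(4 * p)) := by
      gcongr
      rw [show (2 * p) = -(-(2 * p)) by ring, exp_neg (-(2 * p))]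
      gcongr
    have h6 : exp (2 * p) * exp (-(4 * p)) < 1 / 6 := by
      rw [← exp_add, show 2 * p + -(4 * p) = -(2 * p) by ring, exp_neg, one_div]
      gcongr
      have h5 : (2.7 : ℝ) ≤ exp 1 := by linarith [Real.exp_one_gt_d9]
      calc (6 : ℝ) < 2.7 ^ 2 := by norm_num
        _ ≤ exp 1 ^ 2 := by gcongr
        _ = exp 2 := by rw [← exp_nat_mul]; norm_num
        _ ≤ exp (2 * p) := by gcongr; linarith
    linarith

end

/-- The running maximum `max (0, a 0, …, a (m - 1))`. -/
def runMax (a : ℕ → ℝ) : ℕ → ℝ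
  | 0 => 0
  | m + 1 => max (runMax a m) (a m)

lemma runMax_nonneg (a : ℕ → ℝ) : ∀ m, 0 ≤ runMax a m
  | 0 => le_rfl
  | m + 1 => (runMax_nonneg a m).trans (le_max_left _ _)

lemma half_sum_le_sum_runMax {a : ℕ → ℝ} (ha : ∀ m, 0 ≤ a m) {c : ℝ} (hc : 0 ≤ c) (M : ℕ) :
    (∑ m ∈ Finset.range M, c / 2 ^ m * a m ^ 2) / 2 + c / 2 ^ M * runMax a M ^ 2 ≤
      ∑ m ∈ Finset.range M, (runMax a (m + 1) ^ 2 - runMax a m ^ 2) * (c / 2 ^ m) := by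
  induction M with
  | zero => simp [runMax]
  | succ M ih =>
    rw [Finset.sum_range_succ, Finset.sum_range_succ]
    have h1 : a M ^ 2 ≤ runMax a (M + 1) ^ 2 := by
      have : a M ≤ runMax a (M + 1) := le_max_right _ _
      gcongr
      exact ha M
    have h2 : c / 2 ^ (M + 1) = c / 2 ^ M / 2 := by rw [pow_succ, div_div]
    have h3 : 0 ≤ c / 2 ^ M := by positivity
    rw [h2]
    nlinarith

lemma one_add_sq_sq_le_exp {y : ℝ} (hy : 0 ≤ y) : (1 + y ^ 2) ^ 2 ≤ 24 * exp y := by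
  have h := Real.sum_le_exp_of_nonneg hy 5
  simp only [Finset.sum_range_succ, Finset.sum_range_zero, Nat.factorial] at h
  norm_num at h
  nlinarith [pow_nonneg hy 3, sq_nonneg y]

lemma sq_sub_sq_mul_exp_le {x y : ℝ} (hx : 0 ≤ x) (hxy : x ≤ y) :
    (y ^ 2 - x ^ 2) * exp (-y) ≤ 24 * ((1 + x ^ 2)⁻¹ - (1 + y ^ 2)⁻¹) := by
  have h1 := one_add_sq_sq_le_exp (hx.trans hxy)
  have h2 : x ^ 2 ≤ y ^ 2 := by gcongr
  have h3 : exp (-y) ≤ 24 * ((1 + x ^ 2)⁻¹ * (1 + y ^ 2)⁻¹) := by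
    rw [exp_neg, ← mul_inv, inv_eq_one_div, ← div_eq_mul_inv,
      div_le_div_iff₀ (exp_pos _) (by positivity)]
    nlinarith [sq_nonneg x, sq_nonneg y]
  have h4 : 24 * ((1 + x ^ 2)⁻¹ - (1 + y ^ 2)⁻¹) =
      (y ^ 2 - x ^ 2) * (24 * ((1 + x ^ 2)⁻¹ * (1 + y ^ 2)⁻¹)) := by
    field_simp; ring
  rw [h4]
  exact mul_le_mul_of_nonneg_left h3 (by linarith)

lemma sum_sq_sub_sq_mul_exp_le (a : ℕ → ℝ) {b : ℝ} (hb : 0 < b) (M : ℕ) :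
    ∑ m ∈ Finset.range M, (runMax a (m + 1) ^ 2 - runMax a m ^ 2) * exp (-(runMax a (m + 1) / b)) ≤
      24 * b ^ 2 := by
  calc _ ≤ ∑ m ∈ Finset.range M, 24 * b ^ 2 * ((1 + (runMax a m / b) ^ 2)⁻¹ -
        (1 + (runMax a (m + 1) / b) ^ 2)⁻¹) := by
        refine Finset.sum_le_sum fun m _ => ?_
        have h := sq_sub_sq_mul_exp_le (y := runMax a (m + 1) / b)
          (div_nonneg (runMax_nonneg a m) hb.le) (div_le_div_of_nonneg_right (le_max_left _ _ : runMax a m ≤ runMax a (m + 1)) hb.le)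
        have h1 := mul_le_mul_of_nonneg_left h (sq_nonneg b)
        have h2 : ∀ v : ℝ, b ^ 2 * (v / b) ^ 2 = v ^ 2 := fun v => by field_simp
        rw [← mul_assoc, mul_sub, h2, h2] at h1
        linarith
    _ = 24 * b ^ 2 * ((1 + (runMax a 0 / b) ^ 2)⁻¹ - (1 + (runMax a M / b) ^ 2)⁻¹) := by
        rw [← Finset.mul_sum, Finset.sum_range_sub']
    _ ≤ 24 * b ^ 2 * 1 := by
        gcongr
        simp only [runMax, zero_div]
        norm_num
        positivity
    _ = _ := mul_one _

lemma exists_small_exp_sum {ι : Type*} (K : Finset ι) {β : ι → ℝ} (hβ : ∀ i, 0 < β i)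
    {a : ℕ → ℝ} (ha : ∀ m, 0 ≤ a m) (s : ℕ)
    (h : 294912 * ∑ i ∈ K, β i ^ 2 < ∑ m ∈ Finset.range s, 2 ^ s / 2 ^ m * a m ^ 2) :
    ∃ m < s, runMax a m < a m ∧
      3 * ∑ i ∈ K, exp (-(a m / (16 * β i))) ≤ 2 ^ s / 2 ^ m / 8 := by
  by_contra! hcon
  have h1 := half_sum_le_sum_runMax ha (c := 2 ^ s) (by positivity) s
  have h2 : ∑ m ∈ Finset.range s, (runMax a (m + 1) ^ 2 - runMax a m ^ 2) * (2 ^ s / 2 ^ m) ≤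
      ∑ m ∈ Finset.range s, (runMax a (m + 1) ^ 2 - runMax a m ^ 2) *
        (24 * ∑ i ∈ K, exp (-(runMax a (m + 1) / (16 * β i)))) := by
    refine Finset.sum_le_sum fun m hm => ?_
    rcases le_or_gt (a m) (runMax a m) with hle | hlt
    · simp [runMax, max_eq_left hle]
    · have h3 := hcon m (Finset.mem_range.1 hm) hlt
      simp only [runMax, max_eq_right hlt.le]
      refine mul_le_mul_of_nonneg_left (by linarith) (sub_nonneg.2 ?_)
      have := runMax_nonneg a m
      gcongr
  have h3 : ∑ m ∈ Finset.range s, (runMax a (m + 1) ^ 2 - runMax a m ^ 2) *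
        (24 * ∑ i ∈ K, exp (-(runMax a (m + 1) / (16 * β i)))) =
      24 * ∑ i ∈ K, ∑ m ∈ Finset.range s, (runMax a (m + 1) ^ 2 - runMax a m ^ 2) *
        exp (-(runMax a (m + 1) / (16 * β i))) := by
    rw [Finset.sum_comm, Finset.mul_sum]
    refine Finset.sum_congr rfl fun m _ => ?_
    rw [← Finset.mul_sum]; ring
  have h4 : ∑ i ∈ K, ∑ m ∈ Finset.range s, (runMax a (m + 1) ^ 2 - runMax a m ^ 2) *
        exp (-(runMax a (m + 1) / (16 * β i))) ≤ 6144 * ∑ i ∈ K, β i ^ 2 := by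
    rw [Finset.mul_sum]
    refine Finset.sum_le_sum fun i _ => ?_
    have := sum_sq_sub_sq_mul_exp_le a (b := 16 * β i) (by linarith [hβ i]) s
    linarith
  have h5 : 0 ≤ (2 : ℝ) ^ s / 2 ^ s * runMax a s ^ 2 := by positivity
  linarith

/-- The universal constant of the tail bound for truncated order statistics. -/
def truncConst : ℝ := 100000 * normConst

lemma truncConst_pos : 0 < truncConst := by
  have := one_le_normConst
  unfold truncConst; linarith

lemma exp_neg_mul_log_le {b c y : ℝ} (hc : 0 < c) (hb : 6 * c ≤ b) (hy : 2 ≤ y) :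
    exp (-(b * log y / c)) ≤ 1 / (32 * y) := by
  have hlog : 0 ≤ log y := log_nonneg (by linarith)
  have h1 : exp (-(b * log y / c)) ≤ exp (-(6 * log y)) := by
    gcongr
    rw [le_div_iff₀ hc]
    nlinarith
  refine h1.trans ?_
  have h2 : exp (6 * log y) = y ^ 6 := by
    rw [show (6 : ℝ) = (6 : ℕ) by norm_num, exp_nat_mul, exp_log (by linarith)]
  rw [exp_neg, h2, inv_eq_one_div]
  apply one_div_le_one_div_of_le (by linarith)
  calc 32 * y = 2 ^ 5 * y := by norm_num
    _ ≤ y ^ 5 * y := by gcongr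
    _ = y ^ 6 := by ring

section

variable {n : ℕ} {ν : Measure (EuclideanSpace ℝ (Fin n))} [IsProbabilityMeasure ν]

lemma LogConcaveMeasure.exists_good_level (hν : LogConcaveMeasure ν) {p r : ℝ} (hp : 1 ≤ p)
    (hr : 0 < r) (hM : ∀ K : Finset (Fin n), ν.real {x | 8 * K.card < ∑ i ∈ K, x i ^ 2} ≤ 1 / 8)
    (hW : ∀ θ : EuclideanSpace ℝ (Fin n), ‖θ‖ = 1 → ν.real {x | r ≤ |⟪θ, x⟫|} ≤ exp (-p))
    {a : ℕ → ℝ} (ha : ∀ m, 0 ≤ a m) {s : ℕ} (hs : (2 : ℝ) ^ s ≤ 2 * n)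
    (hD : 905969664 * normConst ^ 2 * r ^ 2 < ∑ m ∈ Finset.range s, 2 ^ s / 2 ^ m * a m ^ 2)
    {A : Set (EuclideanSpace ℝ (Fin n))} (hA : MeasurableSet A) (hAc : Convex ℝ A)
    (hAp : exp (-(2 * p)) ≤ ν.real A) :
    ∃ m < s, runMax a m < a m ∧
      ∑ i, √((ν[|A]).real {x | a m + truncConst * log (4 * n / (2 ^ s / 2 ^ m)) ≤ |x i|}) ≤
        2 ^ s / 2 ^ m / 8 := by
  obtain ⟨K, β, hβ, hβK, htail, hsum⟩ := hν.exists_coord_scales hp hr hM hW hA hAc hAp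
  obtain ⟨m, hms, hmax, hm⟩ := exists_small_exp_sum K hβ ha s (by linarith)
  refine ⟨m, hms, hmax, ?_⟩
  have hN := one_le_normConst
  have hn : (0 : ℝ) < n := by
    have : (0 : ℝ) < 2 ^ s := by positivity
    linarith
  set κ : ℝ := 2 ^ s / 2 ^ m with hκ
  have hκ0 : 0 < κ := by positivity
  have hκn : κ ≤ 2 * n := (div_le_self (by positivity) (one_le_pow₀ one_le_two)).trans hs
  have hy : 2 ≤ 4 * n / κ := by rw [le_div_iff₀ hκ0]; linarith
  have hlog : 0 ≤ log (4 * n / κ) := log_nonneg (by linarith)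
  set t : ℝ := a m + truncConst * log (4 * n / κ) with ht
  have hat : a m ≤ t := by have := mul_nonneg truncConst_pos.le hlog; linarith
  have h1 : ∀ i, √((ν[|A]).real {x | t ≤ |x i|}) ≤ 3 / 2 * exp (-(t / (16 * β i))) := fun i => by
    have := hβ i
    refine Real.sqrt_le_iff.2 ⟨by positivity, (htail i t).trans ?_⟩
    rw [mul_pow, ← exp_nat_mul]
    have h2 : ((2 : ℕ) : ℝ) * -(t / (16 * β i)) = -(t / (8 * β i)) := by
      push_cast; field_simp; ring
    rw [h2]
    gcongr
    norm_num
  have h2 : ∀ i, exp (-(t / (16 * β i))) ≤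
      (if i ∈ K then exp (-(a m / (16 * β i))) else 0) + 1 / (32 * (4 * n / κ)) := fun i => by
    have hy0 : 0 < 4 * n / κ := by positivity
    split_ifs with hi
    · have := hβ i
      have h3 : exp (-(t / (16 * β i))) ≤ exp (-(a m / (16 * β i))) := by gcongr
      have : 0 ≤ 1 / (32 * (4 * n / κ)) := by positivity
      linarith
    · rw [zero_add, hβK i hi]
      refine le_trans ?_ (exp_neg_mul_log_le (b := truncConst) (c := 16 * (5 * normConst))
        (by linarith) (by unfold truncConst; linarith) hy)
      gcongr
      linarith [ha m]
  have h3 : ∑ i, √((ν[|A]).real {x | t ≤ |x i|}) ≤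
      3 / 2 * (∑ i ∈ K, exp (-(a m / (16 * β i))) + n * (1 / (32 * (4 * n / κ)))) := by
    calc _ ≤ ∑ i, 3 / 2 * ((if i ∈ K then exp (-(a m / (16 * β i))) else 0) +
          1 / (32 * (4 * n / κ))) := Finset.sum_le_sum fun i _ =>
          (h1 i).trans (mul_le_mul_of_nonneg_left (h2 i) (by norm_num))
      _ = _ := by
          rw [← Finset.mul_sum, Finset.sum_add_distrib, Finset.sum_ite_mem]
          simp
  have h4 : (n : ℝ) * (1 / (32 * (4 * n / κ))) = κ / 128 := by field_simp; norm_num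
  rw [h4] at h3
  linarith

end

section

variable {n : ℕ} {ν : Measure (EuclideanSpace ℝ (Fin n))} [IsProbabilityMeasure ν]

lemma mul_measureReal_le_sum_measureReal_inter {S : Set (EuclideanSpace ℝ (Fin n))} {k t : ℝ}
    (hk : ∀ x ∈ S, k ≤ (Finset.univ.filter fun i => t ≤ |x i|).card) (hS : MeasurableSet S) :
    k * ν.real S ≤ ∑ i, ν.real (S ∩ {x | t ≤ |x i|}) := by
  have hB : ∀ i : Fin n, MeasurableSet {x : EuclideanSpace ℝ (Fin n) | t ≤ |x i|} := fun i =>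
    measurableSet_le measurable_const (by fun_prop)
  have h1 : ∑ i, ν.real (S ∩ {x | t ≤ |x i|}) = ∫ x, ∑ i,
      (S ∩ {x : EuclideanSpace ℝ (Fin n) | t ≤ |x i|}).indicator (fun _ => (1 : ℝ)) x ∂ν := by
    rw [integral_finsetSum _ fun i _ => (integrable_const _).indicator (hS.inter (hB i))]
    refine Finset.sum_congr rfl fun i _ => ?_
    rw [integral_indicator_const _ (hS.inter (hB i)), smul_eq_mul, mul_one]
  have h2 : k * ν.real S = ∫ x, S.indicator (fun _ => k) x ∂ν := by
    rw [integral_indicator_const _ hS, smul_eq_mul, mul_comm]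
  rw [h1, h2]
  refine integral_mono ((integrable_const _).indicator hS) (integrable_finsetSum _ fun i _ =>
    (integrable_const _).indicator (hS.inter (hB i))) fun x => ?_
  by_cases hx : x ∈ S
  · have h3 : ∀ i, (S ∩ {x : EuclideanSpace ℝ (Fin n) | t ≤ |x i|}).indicator
        (fun _ => (1 : ℝ)) x = if t ≤ |x i| then 1 else 0 := fun i => by
      classical
      rw [Set.indicator_apply]
      exact if_congr (by simp [hx]) rfl rfl
    simp only [Set.indicator_of_mem hx, h3, Finset.sum_boole]
    exact hk x hx
  · have h3 : ∀ i, x ∉ S ∩ {x : EuclideanSpace ℝ (Fin n) | t ≤ |x i|} := fun i h => hx h.1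
    simp [hx]

lemma convex_setOf_le_mul_apply (t ε : ℝ) (i : Fin n) :
    Convex ℝ {x : EuclideanSpace ℝ (Fin n) | t ≤ ε * x i} :=
  convex_halfSpace_ge (f := fun x : EuclideanSpace ℝ (Fin n) => ε * x i)
    ⟨fun x y => by simp [mul_add], fun c x => by simp; ring⟩ t

lemma measureReal_le_exp_of_recursion {p : ℝ} {E : Set (EuclideanSpace ℝ (Fin n))}
    (hE : MeasurableSet E)
    (h : ∀ A, MeasurableSet A → Convex ℝ A → exp (-(2 * p)) ≤ ν.real A → ∃ t k : ℝ, 0 < k ∧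
      (∀ x ∈ E, k ≤ (Finset.univ.filter fun i => t ≤ |x i|).card) ∧
      ∑ i, √((ν[|A]).real {x | t ≤ |x i|}) ≤ k / 4) :
    ν.real E ≤ exp (-p) := by
  have key : ∀ L : ℕ, ∀ A, MeasurableSet A → Convex ℝ A →
      ν.real (A ∩ E) ≤ (exp (-p) + (1 / 2) ^ L) * √(ν.real A) := by
    intro L
    induction L with
    | zero =>
      intro A _ _
      have h1 : ν.real A ≤ √(ν.real A) := by
        refine Real.le_sqrt_of_sq_le ?_
        have := measureReal_le_one (μ := ν) (s := A)
        have := measureReal_nonneg (μ := ν) (s := A)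
        nlinarith
      have h2 : ν.real (A ∩ E) ≤ ν.real A :=
        measureReal_mono Set.inter_subset_left (measure_ne_top _ _)
      have := exp_pos (-p)
      have := Real.sqrt_nonneg (ν.real A)
      rw [pow_zero]
      nlinarith
    | succ L ih =>
      intro A hA hAc
      rcases le_or_gt (exp (-(2 * p))) (ν.real A) with hlarge | hsmall
      · obtain ⟨t, k, hk, hcount, hsum⟩ := h A hA hAc hlarge
        have hA0 : 0 < ν.real A := (exp_pos _).trans_le hlarge
        set Φ : ℝ := exp (-p) + (1 / 2) ^ L with hΦ
        have hΦ0 : 0 < Φ := by positivity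
        have hhalf : ∀ i : Fin n, ∀ ε : ℝ, |ε| = 1 → ν.real (A ∩ {x | t ≤ ε * x i} ∩ E) ≤
            Φ * (√(ν.real A) * √((ν[|A]).real {x | t ≤ |x i|})) := fun i ε hε => by
          refine (ih _ (hA.inter (measurableSet_le measurable_const (by fun_prop)))
            (hAc.inter (convex_setOf_le_mul_apply t ε i))).trans ?_
          rw [← Real.sqrt_mul hA0.le, measureReal_cond hA, mul_inv_cancel_left₀ hA0.ne']
          gcongr Φ * √?_
          refine measureReal_mono (μ := ν) (Set.inter_subset_inter_right _ fun x hx => ?_)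
            (measure_ne_top _ _)
          rw [Set.mem_ofPred_eq] at hx ⊢
          refine hx.trans ((le_abs_self _).trans_eq ?_)
          rw [abs_mul, hε, one_mul]
        have h1 : ∀ i : Fin n, ν.real (A ∩ E ∩ {x | t ≤ |x i|}) ≤
            2 * Φ * √(ν.real A) * √((ν[|A]).real {x | t ≤ |x i|}) := fun i => by
          have h2 : A ∩ E ∩ {x | t ≤ |x i|} ⊆
              (A ∩ {x | t ≤ 1 * x i} ∩ E) ∪ (A ∩ {x | t ≤ -1 * x i} ∩ E) := by
            rintro x ⟨⟨hxA, hxE⟩, hx⟩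
            rw [Set.mem_ofPred_eq] at hx
            rcases le_abs.1 hx with hx | hx
            · exact Or.inl ⟨⟨hxA, by simpa using hx⟩, hxE⟩
            · exact Or.inr ⟨⟨hxA, by simpa using hx⟩, hxE⟩
          have h3 := (measureReal_mono h2 (measure_ne_top ν _)).trans (measureReal_union_le _ _)
          have h4 := hhalf i 1 (by simp)
          have h5 := hhalf i (-1) (by simp)
          linarith
        have h2 := mul_measureReal_le_sum_measureReal_inter (ν := ν) (S := A ∩ E)
          (fun x hx => hcount x hx.2) (hA.inter hE)
        have h3 : k * ν.real (A ∩ E) ≤ 2 * Φ * √(ν.real A) * (k / 4) := by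
          refine (h2.trans (Finset.sum_le_sum fun i _ => h1 i)).trans ?_
          rw [← Finset.mul_sum]
          gcongr
        have h4 : ν.real (A ∩ E) ≤ Φ / 2 * √(ν.real A) := by
          rw [← mul_le_mul_iff_right₀ hk]
          linarith
        refine h4.trans ?_
        gcongr
        rw [hΦ, pow_succ]
        linarith [exp_pos (-p)]
      · have h1 : √(ν.real A) ≤ exp (-p) := by
          rw [Real.sqrt_le_left (exp_pos _).le, ← exp_nat_mul]
          refine hsmall.le.trans_eq ?_
          congr 1; push_cast; ring
        calc ν.real (A ∩ E) ≤ ν.real A :=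
              measureReal_mono Set.inter_subset_left (measure_ne_top _ _)
          _ = √(ν.real A) * √(ν.real A) := (Real.mul_self_sqrt measureReal_nonneg).symm
          _ ≤ exp (-p) * √(ν.real A) := by gcongr
          _ ≤ _ := by gcongr; simp
  have h1 : ∀ L : ℕ, ν.real E ≤ exp (-p) + (1 / 2) ^ L := fun L => by
    simpa using key L Set.univ MeasurableSet.univ convex_univ
  refine ge_of_tendsto' (f := fun L : ℕ => exp (-p) + (1 / 2 : ℝ) ^ L) (b := ν.real E)
    (x := Filter.atTop) ?_ h1
  simpa using (tendsto_const_nhds (x := exp (-p))).add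
    (tendsto_pow_atTop_nhds_zero_of_lt_one (r := (1 / 2 : ℝ)) (by norm_num) (by norm_num))

lemma measurableSet_level_counts (s : ℕ) (P : ℕ → Prop) (k t : ℕ → ℝ) :
    MeasurableSet {x : EuclideanSpace ℝ (Fin n) | ∀ m < s, P m →
      k m ≤ (Finset.univ.filter fun i => t m ≤ |x i|).card} := by
  have h : ∀ m, Measurable fun x : EuclideanSpace ℝ (Fin n) =>
      ((Finset.univ.filter fun i => t m ≤ |x i|).card : ℝ) := fun m => by
    simp only [← Finset.sum_boole]
    refine Finset.measurable_sum _ fun i _ => Measurable.ite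
      (measurableSet_le measurable_const (by fun_prop)) measurable_const measurable_const
  simp only [Set.ofPred_forall]
  exact MeasurableSet.iInter fun m => MeasurableSet.iInter fun _ => MeasurableSet.iInter fun _ =>
    measurableSet_le measurable_const (h m)

/-- Joint tail bound for the numbers of coordinates exceeding several levels. -/
lemma LogConcaveMeasure.measureReal_level_counts_le (hν : LogConcaveMeasure ν) {p r : ℝ}
    (hp : 1 ≤ p) (hr : 0 < r)
    (hM : ∀ K : Finset (Fin n), ν.real {x | 8 * K.card < ∑ i ∈ K, x i ^ 2} ≤ 1 / 8)
    (hW : ∀ θ : EuclideanSpace ℝ (Fin n), ‖θ‖ = 1 → ν.real {x | r ≤ |⟪θ, x⟫|} ≤ exp (-p))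
    {a : ℕ → ℝ} (ha : ∀ m, 0 ≤ a m) {s : ℕ} (hs : (2 : ℝ) ^ s ≤ 2 * n)
    (hD : 905969664 * normConst ^ 2 * r ^ 2 < ∑ m ∈ Finset.range s, 2 ^ s / 2 ^ m * a m ^ 2) :
    ν.real {x | ∀ m < s, runMax a m < a m → (2 : ℝ) ^ s / 2 ^ m / 2 ≤ (Finset.univ.filter
      fun i => a m + truncConst * log (4 * n / (2 ^ s / 2 ^ m)) ≤ |x i|).card} ≤ exp (-p) := by
  refine measureReal_le_exp_of_recursion (measurableSet_level_counts s _ _ _)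
    fun A hA hAc hAp => ?_
  obtain ⟨m, hm, hmax, hsum⟩ := hν.exists_good_level hp hr hM hW ha hs hD hA hAc hAp
  exact ⟨_, 2 ^ s / 2 ^ m / 2, by positivity, fun x hx => hx m hm hmax, by linarith⟩

end

section

variable {n : ℕ} {ν : Measure (EuclideanSpace ℝ (Fin n))}

lemma integrable_sq_apply (h : ∀ i, ∫ x, x i ^ 2 ∂ν = 1) (i : Fin n) :
    Integrable (fun x => x i ^ 2) ν :=
  Integrable.of_integral_ne_zero (by rw [h i]; exact one_ne_zero)

variable [IsProbabilityMeasure ν]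

lemma measureReal_sum_sq_le (h : ∀ i, ∫ x, x i ^ 2 ∂ν = 1) (K : Finset (Fin n)) :
    ν.real {x | 8 * K.card < ∑ i ∈ K, x i ^ 2} ≤ 1 / 8 := by
  rcases K.eq_empty_or_nonempty with rfl | hK
  · simp
  have h0 : (0 : ℝ) < K.card := by exact_mod_cast hK.card_pos
  have h1 := mul_meas_ge_le_integral_of_nonneg (μ := ν) (f := fun x => ∑ i ∈ K, x i ^ 2)
    (ae_of_all _ fun x => Finset.sum_nonneg fun i _ => sq_nonneg _)
    (integrable_finsetSum _ fun i _ => integrable_sq_apply h i) (8 * K.card)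
  rw [integral_finsetSum _ fun i _ => integrable_sq_apply h i] at h1
  simp only [h, Finset.sum_const, nsmul_eq_mul, mul_one] at h1
  have h2 : ν.real {x | 8 * (K.card : ℝ) < ∑ i ∈ K, x i ^ 2} ≤
      ν.real {x | 8 * (K.card : ℝ) ≤ ∑ i ∈ K, x i ^ 2} :=
    measureReal_mono (fun x (hx : 8 * (K.card : ℝ) < ∑ i ∈ K, x i ^ 2) => hx.le)
      (measure_ne_top _ _)
  refine h2.trans ?_
  rw [← mul_le_mul_iff_right₀ h0]
  linarith

lemma LogConcaveMeasure.exists_norm_tail_le (hν : LogConcaveMeasure ν)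
    (h : ∀ i, ∫ x, x i ^ 2 ∂ν = 1) :
    ∃ b > 0, ∀ t > 0, ν.real {x | t ≤ ‖x‖} ≤ exp 1 * exp (-b * t) := by
  obtain ⟨r, hr0, hr⟩ : ∃ r > 0, ν.real {x | r ≤ ‖x‖} ≤ exp (-1) := by
    refine ⟨√(8 * n + 1), by positivity, le_trans (measureReal_mono ?_ (measure_ne_top _ _))
      ((measureReal_sum_sq_le h Finset.univ).trans ?_)⟩
    · intro x hx
      rw [Set.mem_ofPred_eq] at hx ⊢
      rw [Real.sqrt_le_left (norm_nonneg x), EuclideanSpace.real_norm_sq_eq] at hx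
      simp only [Finset.card_univ, Fintype.card_fin]
      linarith
    · rw [exp_neg, one_div]
      gcongr
      exact exp_one_lt_three.le.trans (by norm_num)
  refine ⟨1 / (4 * r), by positivity, fun t ht => ?_⟩
  rw [← exp_add]
  rcases le_total t r with htr | htr
  · refine measureReal_le_one.trans ?_
    have h1 : 1 / (4 * r) * t ≤ 1 := by
      rw [one_div_mul_eq_div, div_le_one (by positivity)]; linarith
    exact one_le_exp (by linarith)
  · have h1 := hν.tail_le (ContinuousLinearMap.id ℝ (EuclideanSpace ℝ (Fin n))) le_rfl
      (t := t / r) (by rwa [one_le_div hr0]) (r := r) hr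
    rw [div_mul_cancel₀ _ hr0.ne'] at h1
    refine h1.trans (exp_le_exp.2 ?_)
    have : 1 * (t / r) / 4 = 1 / (4 * r) * t := by field_simp
    linarith

lemma LogConcaveMeasure.integrable_norm_rpow (hν : LogConcaveMeasure ν)
    (h : ∀ i, ∫ x, x i ^ 2 ∂ν = 1) {p : ℝ} (hp : 1 ≤ p) :
    Integrable (fun x => ‖x‖ ^ p) ν := by
  obtain ⟨b, hb, htail⟩ := hν.exists_norm_tail_le h
  refine ⟨(measurable_norm.pow_const p).aestronglyMeasurable, ?_⟩
  rw [hasFiniteIntegral_iff_ofReal (ae_of_all _ fun x => by positivity),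
    lintegral_rpow_eq_lintegral_meas_le_mul ν (ae_of_all _ fun x => norm_nonneg x)
      measurable_norm.aemeasurable (by linarith)]
  refine ENNReal.mul_lt_top ENNReal.ofReal_lt_top ?_
  have h1 : IntegrableOn (fun t : ℝ => exp 1 * (t ^ (p - 1) * exp (-b * t ^ (1 : ℝ))))
      (Set.Ioi 0) :=
    (integrableOn_rpow_mul_exp_neg_mul_rpow (by linarith) zero_lt_one hb).const_mul _
  refine lt_of_le_of_lt (setLIntegral_mono' measurableSet_Ioi fun t ht => ?_)
    h1.lintegral_lt_top
  rw [← ofReal_measureReal, ← ENNReal.ofReal_mul measureReal_nonneg]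
  refine ENNReal.ofReal_le_ofReal ?_
  have h2 := mul_le_mul_of_nonneg_right (htail t ht) (rpow_nonneg (le_of_lt ht) (p - 1))
  rw [rpow_one]
  linarith

lemma abs_inner_rpow_le {θ : EuclideanSpace ℝ (Fin n)} (hθ : ‖θ‖ = 1) {p : ℝ} (hp : 1 ≤ p)
    (x : EuclideanSpace ℝ (Fin n)) : |⟪θ, x⟫| ^ p ≤ ‖x‖ ^ p := by
  refine rpow_le_rpow (abs_nonneg _) ?_ (by linarith)
  simpa [hθ] using abs_real_inner_le_norm θ x

lemma LogConcaveMeasure.integrable_abs_inner_rpow (hν : LogConcaveMeasure ν)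
    (h : ∀ i, ∫ x, x i ^ 2 ∂ν = 1) {p : ℝ} (hp : 1 ≤ p) {θ : EuclideanSpace ℝ (Fin n)}
    (hθ : ‖θ‖ = 1) : Integrable (fun x => |⟪θ, x⟫| ^ p) ν := by
  refine (hν.integrable_norm_rpow h hp).mono'
    (Measurable.aestronglyMeasurable (by fun_prop)) (ae_of_all _ fun x => ?_)
  rw [Real.norm_of_nonneg (by positivity)]
  exact abs_inner_rpow_le hθ hp x

lemma LogConcaveMeasure.integral_abs_inner_rpow_le (hν : LogConcaveMeasure ν)
    (h : ∀ i, ∫ x, x i ^ 2 ∂ν = 1) {p : ℝ} (hp : 1 ≤ p) {θ : EuclideanSpace ℝ (Fin n)}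
    (hθ : ‖θ‖ = 1) {σ : ℝ} (hσ : sigmaX ν id p ≤ σ) :
    0 ≤ σ ∧ ∫ x, |⟪θ, x⟫| ^ p ∂ν ≤ σ ^ p := by
  have hp0 : p ≠ 0 := by linarith
  have h0 : ∀ η : EuclideanSpace ℝ (Fin n), 0 ≤ ∫ x, |⟪η, x⟫| ^ p ∂ν := fun η =>
    integral_nonneg fun x => by positivity
  have hbdd : BddAbove (Set.range fun t : {t : EuclideanSpace ℝ (Fin n) // ‖t‖ = 1} =>
      (∫ x, |⟪t.1, id x⟫| ^ p ∂ν) ^ (1 / p)) := by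
    refine ⟨(∫ x, ‖x‖ ^ p ∂ν) ^ (1 / p), ?_⟩
    rintro _ ⟨t, rfl⟩
    refine rpow_le_rpow (h0 _) ?_ (by positivity)
    exact integral_mono (hν.integrable_abs_inner_rpow h hp t.2) (hν.integrable_norm_rpow h hp)
      fun x => abs_inner_rpow_le t.2 hp x
  have h1 : (∫ x, |⟪θ, x⟫| ^ p ∂ν) ^ (1 / p) ≤ σ := (le_ciSup hbdd ⟨θ, hθ⟩).trans hσ
  refine ⟨(rpow_nonneg (h0 θ) _).trans h1, ?_⟩
  have h2 := rpow_le_rpow (rpow_nonneg (h0 θ) _) h1 (z := p) (by linarith)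
  rwa [← rpow_mul (h0 θ), one_div_mul_cancel hp0, rpow_one] at h2

lemma LogConcaveMeasure.measureReal_abs_inner_ge_le (hν : LogConcaveMeasure ν)
    (h : ∀ i, ∫ x, x i ^ 2 ∂ν = 1) {p : ℝ} (hp : 1 ≤ p) {θ : EuclideanSpace ℝ (Fin n)}
    (hθ : ‖θ‖ = 1) {σ : ℝ} (hσ0 : 0 < σ) (hσ : sigmaX ν id p ≤ σ) :
    ν.real {x | exp 1 * σ ≤ |⟪θ, x⟫|} ≤ exp (-p) := by
  have h1 := mul_meas_ge_le_integral_of_nonneg (ae_of_all _ fun x => by positivity)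
    (hν.integrable_abs_inner_rpow h hp hθ) ((exp 1 * σ) ^ p)
  have h2 := h1.trans (hν.integral_abs_inner_rpow_le h hp hθ hσ).2
  have h3 : ν.real {x | exp 1 * σ ≤ |⟪θ, x⟫|} ≤
      ν.real {x | (exp 1 * σ) ^ p ≤ |⟪θ, x⟫| ^ p} := by
    refine measureReal_mono (fun x hx => ?_) (measure_ne_top _ _)
    rw [Set.mem_ofPred_eq] at hx ⊢
    exact rpow_le_rpow (by positivity) hx (by linarith)
  refine h3.trans ?_
  have h4 : 0 < σ ^ p := rpow_pos_of_pos hσ0 p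
  rw [mul_rpow (exp_pos 1).le hσ0.le, exp_one_rpow] at h2 ⊢
  rw [exp_neg, inv_eq_one_div, le_div_iff₀ (exp_pos p), ← mul_le_mul_iff_right₀ h4]
  linarith

lemma LogConcaveMeasure.sigmaX_pos (hν : LogConcaveMeasure ν) (h : ∀ i, ∫ x, x i ^ 2 ∂ν = 1)
    (hn : 0 < n) {p : ℝ} (hp : 1 ≤ p) : 0 < sigmaX ν id p := by
  by_contra! hcon
  let i : Fin n := ⟨0, hn⟩
  have hθ : ‖(EuclideanSpace.single i 1 : EuclideanSpace ℝ (Fin n))‖ = 1 := by simp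
  have hp0 : p ≠ 0 := by linarith
  have h1 := (hν.integral_abs_inner_rpow_le h hp hθ hcon).2
  rw [zero_rpow hp0] at h1
  have h2 := (integral_eq_zero_iff_of_nonneg (fun x => by positivity)
    (hν.integrable_abs_inner_rpow h hp hθ)).1
    (le_antisymm h1 (integral_nonneg fun x => by positivity))
  have h3 : ∫ x, x i ^ 2 ∂ν = 0 := by
    refine integral_eq_zero_of_ae ?_
    filter_upwards [h2] with x hx
    have h4 : |x i| = 0 := by
      simpa [rpow_eq_zero_iff_of_nonneg, hp0, EuclideanSpace.inner_single_left] using hx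
    simp [abs_eq_zero.1 h4]
  rw [h i] at h3
  exact one_ne_zero h3

end

lemma le_card_filter_of_le_orderStat {n : ℕ} {x : Fin n → ℝ} {k : ℕ} {t : ℝ} (ht : 0 < t)
    (h : t ≤ orderStat x k) : k ≤ (Finset.univ.filter fun i => t ≤ |x i|).card := by
  unfold orderStat at h
  rcases isEmpty_or_nonempty {I : Finset (Fin n) // I.card = k} with he | he
  · rw [Real.iSup_of_isEmpty] at h
    exact absurd h (not_le.2 ht)
  · obtain ⟨I, hI⟩ := exists_eq_ciSup_of_finite
      (f := fun I : {I : Finset (Fin n) // I.card = k} => ⨅ i : I.1, |x i|)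
    rw [← hI] at h
    rw [← I.2]
    refine Finset.card_le_card fun i hi => ?_
    simp only [Finset.mem_filter, Finset.mem_univ, true_and]
    exact h.trans (ciInf_le (f := fun i : I.1 => |x i|) (Set.finite_range _).bddBelow ⟨i, hi⟩)

lemma sigmaX_eq_map {n : ℕ} {μ : Measure Ω} {X : Ω → EuclideanSpace ℝ (Fin n)}
    (hX : Measurable X) (p : ℝ) : sigmaX μ X p = sigmaX (μ.map X) id p := by
  unfold sigmaX
  congr 1 with t
  rw [integral_map hX.aemeasurable (Measurable.aestronglyMeasurable (by fun_prop))]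
  rfl

lemma two_pow_le_of_le_logb {n s : ℕ} (hn : 0 < n) (hs : (s : ℝ) ≤ 1 + Real.logb 2 n) :
    (2 : ℝ) ^ s ≤ 2 * n := by
  have hn' : (0 : ℝ) < n := by exact_mod_cast hn
  calc (2 : ℝ) ^ s = 2 ^ (s : ℝ) := (rpow_natCast _ _).symm
    _ ≤ 2 ^ (1 + Real.logb 2 n) := rpow_le_rpow_of_exponent_le one_le_two hs
    _ = 2 * n := by
      rw [rpow_add two_pos, rpow_one, rpow_logb two_pos (by norm_num) hn']

lemma sum_Icc_eq_sum_range_reflect (s : ℕ) (u : ℕ → ℝ) :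
    ∑ j ∈ Finset.Icc 1 s, (2 : ℝ) ^ j * u j ^ 2 =
      ∑ m ∈ Finset.range s, 2 ^ s / 2 ^ m * u (s - m) ^ 2 := by
  refine Finset.sum_nbij' (fun j => s - j) (fun m => s - m) ?_ ?_ ?_ ?_ ?_
  · intro j hj; simp only [Finset.mem_Icc, Finset.mem_range] at hj ⊢; omega
  · intro m hm; simp only [Finset.mem_Icc, Finset.mem_range] at hm ⊢; omega
  · intro j hj; simp only [Finset.mem_Icc] at hj; omega
  · intro m hm; simp only [Finset.mem_range] at hm; omega
  · intro j hj
    simp only [Finset.mem_Icc] at hj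
    rw [Nat.sub_sub_self hj.2, eq_div_of_mul_eq (by positivity) ((pow_add (2 : ℝ) j (s - j)).symm.trans (by rw [Nat.add_sub_cancel' hj.2]))]

/-- The joint tail bound for truncated order statistics, with a single moment `p`. -/
lemma measureReal_truncated_orderStat_le {μ : Measure Ω} [IsProbabilityMeasure μ] {n : ℕ}
    {X : Ω → EuclideanSpace ℝ (Fin n)} (hX : Measurable X) (hlc : IsLogConcave μ X)
    (hiso : IsIsotropic μ X) (hn : 0 < n) {s : ℕ} (hs : (2 : ℝ) ^ s ≤ 2 * n) {u : ℕ → ℝ}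
    (hu : ∀ j, 1 ≤ j → j ≤ s → 0 ≤ u j) {p : ℝ} (hp : 1 ≤ p)
    (hσ : sigmaX μ X p ≤ 1 / (2 * truncConst) * √(∑ j ∈ Finset.Icc 1 s, 2 ^ j * u j ^ 2)) :
    μ.real {ω | ∀ j, 1 ≤ j → j ≤ s → u j ≤ max (orderStat (fun i => X ω i) (2 ^ (j - 1)) -
      truncConst * log (4 * (n : ℝ) / 2 ^ j)) 0} ≤ exp (-p) := by
  have hprob : IsProbabilityMeasure (μ.map X) := Measure.isProbabilityMeasure_map hX.aemeasurable
  have hν := IsLogConcave.logConcaveMeasure_map hX hlc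
  have hsq : ∀ i, ∫ x, x i ^ 2 ∂(μ.map X) = 1 := fun i => by
    rw [integral_map hX.aemeasurable (Measurable.aestronglyMeasurable (by fun_prop))]
    simpa [sq] using hiso.2 i i
  rw [sigmaX_eq_map hX] at hσ
  have hσ0 := (hν.sigmaX_pos hsq hn hp).trans_le hσ
  have hN := one_le_normConst
  have hC := truncConst_pos
  have hn' : (0 : ℝ) < n := by exact_mod_cast hn
  set a : ℕ → ℝ := fun m => if m < s then u (s - m) else 0 with ha_def
  have ha : ∀ m, 0 ≤ a m := fun m => by
    simp only [ha_def]
    split_ifs with hm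
    · exact hu _ (by omega) (by omega)
    · exact le_rfl
  set D : ℝ := ∑ j ∈ Finset.Icc 1 s, 2 ^ j * u j ^ 2 with hD_def
  have hD : D = ∑ m ∈ Finset.range s, 2 ^ s / 2 ^ m * a m ^ 2 := by
    rw [hD_def, sum_Icc_eq_sum_range_reflect]
    refine Finset.sum_congr rfl fun m hm => ?_
    simp only [ha_def, if_pos (Finset.mem_range.1 hm)]
  have hD0 : 0 < D := by
    by_contra! h
    rw [Real.sqrt_eq_zero_of_nonpos h, mul_zero] at hσ0
    exact lt_irrefl _ hσ0
  have hr : 905969664 * normConst ^ 2 * (exp 1 * (1 / (2 * truncConst) * √D)) ^ 2 < D := by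
    have h1 : 905969664 * normConst ^ 2 * (exp 1 * (1 / (2 * truncConst) * √D)) ^ 2 =
        905969664 / 40000000000 * exp 1 ^ 2 * D := by
      rw [mul_pow, mul_pow, Real.sq_sqrt hD0.le, truncConst]
      field_simp
      norm_num
    have h2 : exp 1 ^ 2 < 3 ^ 2 := by
      have := exp_one_lt_three
      gcongr
    rw [h1]
    nlinarith
  have hlevel := hν.measureReal_level_counts_le hp (mul_pos (exp_pos 1) hσ0)
    (measureReal_sum_sq_le hsq)
    (fun θ hθ => hν.measureReal_abs_inner_ge_le hsq hp hθ hσ0 hσ) ha hs (by rwa [← hD])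
  rw [map_measureReal_apply hX (measurableSet_level_counts s _ _ _)] at hlevel
  refine (measureReal_mono (fun ω hω => ?_) (measure_ne_top _ _)).trans hlevel
  rw [Set.mem_ofPred_eq] at hω
  rw [Set.mem_preimage, Set.mem_ofPred_eq]
  intro m hm hmax
  have ham : 0 < a m := (runMax_nonneg a m).trans_lt hmax
  have h1 := hω (s - m) (by omega) (by omega)
  have h2 : (2 : ℝ) ^ s / 2 ^ m = 2 ^ (s - m) := by
    rw [div_eq_iff (by positivity), ← pow_add, Nat.sub_add_cancel hm.le]
  have h3 : (2 : ℝ) ^ s / 2 ^ m / 2 = ((2 ^ (s - m - 1) : ℕ) : ℝ) := by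
    rw [h2, div_eq_iff two_ne_zero, Nat.cast_pow, Nat.cast_ofNat, ← pow_succ]
    congr 1; omega
  have h4 : a m = u (s - m) := if_pos hm
  have hlog : 0 ≤ log (4 * (n : ℝ) / 2 ^ (s - m)) := by
    refine log_nonneg ?_
    rw [one_le_div (by positivity)]
    have : (2 : ℝ) ^ (s - m) ≤ 2 ^ s := pow_le_pow_right₀ one_le_two (Nat.sub_le s m)
    linarith
  rw [h3, h2]
  rw [← h4] at h1
  have h5 := (le_max_iff.1 h1).resolve_right (not_le.2 ham)
  have h6 := mul_nonneg hC.le hlog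
  exact Nat.cast_le.2 (le_card_filter_of_le_orderStat (x := fun i => X ω i) (by linarith)
    (by linarith))

/-- **Corollary.** There is a universal constant `C > 0` such that for every isotropic
log-concave random vector `X` in `ℝⁿ`, with `Y j := (X*_{2^(j−1)} − C·log(4n·2^{−j}))₊` for
`1 ≤ j ≤ 1 + log₂ n`, every `1 ≤ s ≤ 1 + log₂ n` and all `u 1, …, u s ≥ 0`,
`P(Y 1 ≥ u 1, …, Y s ≥ u s) ≤ exp(−σ_X⁻¹((1/(2C))·√(∑_{j=1}^s 2^j·(u j)²)))`. -/
theorem joint_truncated_order_statistics :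
    ∃ C : ℝ, 0 < C ∧
      ∀ (Ω : Type) (_ : MeasurableSpace Ω) (μ : Measure Ω), IsProbabilityMeasure μ →
      ∀ (n : ℕ) (X : Ω → EuclideanSpace ℝ (Fin n)), Measurable X →
      IsLogConcave μ X → IsIsotropic μ X →
      ∀ s : ℕ, 1 ≤ s → (s : ℝ) ≤ 1 + Real.logb 2 n →
      ∀ u : ℕ → ℝ, (∀ j, 1 ≤ j → j ≤ s → 0 ≤ u j) →
        (μ {ω | ∀ j, 1 ≤ j → j ≤ s →
            u j ≤ max (orderStat (fun i => X ω i) (2 ^ (j - 1)) -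
              C * Real.log (4 * (n : ℝ) / 2 ^ j)) 0}).toReal ≤
          Real.exp (-(sigmaXInv μ X ((1 / (2 * C)) *
            Real.sqrt (∑ j ∈ Finset.Icc 1 s, 2 ^ j * (u j) ^ 2)))) := by
  refine ⟨truncConst, truncConst_pos, fun Ω _ μ _ n X hX hlc hiso s _ hs u hu => ?_⟩
  unfold sigmaXInv
  set σ : ℝ := 1 / (2 * truncConst) * √(∑ j ∈ Finset.Icc 1 s, 2 ^ j * u j ^ 2) with hσ_def
  have hσ0 : 0 ≤ σ := by have := truncConst_pos; positivity
  have htriv : sSup {p : ℝ | 1 ≤ p ∧ sigmaX μ X p ≤ σ} = 0 →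
      (μ {ω | ∀ j, 1 ≤ j → j ≤ s → u j ≤ max (orderStat (fun i => X ω i) (2 ^ (j - 1)) -
        truncConst * Real.log (4 * (n : ℝ) / 2 ^ j)) 0}).toReal ≤
      exp (-sSup {p : ℝ | 1 ≤ p ∧ sigmaX μ X p ≤ σ}) := fun h => by
    rw [h, neg_zero, exp_zero]
    exact measureReal_le_one
  rcases Nat.eq_zero_or_pos n with rfl | hn
  · refine htriv (Real.sSup_of_not_bddAbove fun ⟨b, hb⟩ => ?_)
    have hemp : IsEmpty {t : EuclideanSpace ℝ (Fin 0) // ‖t‖ = 1} :=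
      ⟨fun t => by have := t.2; simp [Subsingleton.elim t.1 0] at this⟩
    have h1 : max 1 (b + 1) ∈ {p : ℝ | 1 ≤ p ∧ sigmaX μ X p ≤ σ} :=
      ⟨le_max_left _ _, by rwa [sigmaX, Real.iSup_of_isEmpty]⟩
    linarith [hb h1, le_max_right 1 (b + 1)]
  · rcases Set.eq_empty_or_nonempty {p : ℝ | 1 ≤ p ∧ sigmaX μ X p ≤ σ} with he | hne
    · exact htriv (by rw [he, Real.sSup_empty])
    · refine le_of_forall_gt_imp_ge_of_dense fun c hc => ?_
      have hc0 : 0 < c := (exp_pos _).trans hc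
      have h1 : -log c < sSup {p : ℝ | 1 ≤ p ∧ sigmaX μ X p ≤ σ} := by
        have := (lt_log_iff_exp_lt hc0).2 hc
        linarith
      obtain ⟨p, ⟨hp, hpσ⟩, hlt⟩ := exists_lt_of_lt_csSup hne h1
      refine (measureReal_truncated_orderStat_le hX hlc hiso hn
        (two_pow_le_of_le_logb hn hs) hu hp hpσ).trans ?_
      rw [← le_log_iff_exp_le hc0]
      linarith

end
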